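/- Let A be a partition of length at most l, J a subdivision of {1,…,l}, and let 1 ≤ δ < β be column indices with ã_β > 0 and ã_δ < l. Set m = J(ã_β) and n = J(ã_δ + 1). Then H_J(A,m,n) is a partition, and it has positive multiplicity in the power (s_A)^{L(l)} of the Schur function of A. -/

import Mathlib

open Finset MvPolynomial

/-- `hp l k` is the complete homogeneous symmetric polynomial `h_k` in `l` variables,
interpreted as `0` for negative `k` (and `h_0 = 1`). -/
noncomputable def hp (l : ℕ) (k : ℤ) : MvPolynomial (Fin l) ℤ :=
  if 0 ≤ k then MvPolynomial.hsymm (Fin l) ℤ k.toNat else 0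

/-- The Schur polynomial of a partition (given as a weakly decreasing `l`-tuple) in `l`
variables, defined by the Jacobi–Trudi determinant `s_A = det (h_{A i - i + j})`. -/
noncomputable def schur (l : ℕ) (A : Fin l → ℕ) : MvPolynomial (Fin l) ℤ :=
  Matrix.det (Matrix.of fun i j : Fin l => hp l ((A i : ℤ) + (j : ℕ) - (i : ℕ)))

/-- The Vandermonde alternant `a_δ = det (x_i ^ (l - 1 - j))`. -/
noncomputable def vdm (l : ℕ) : MvPolynomial (Fin l) ℤ :=
  Matrix.det (Matrix.of fun i j : Fin l => (X i : MvPolynomial (Fin l) ℤ) ^ (l - 1 - (j : ℕ)))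

/-- The multiplicity (coefficient) of the Schur polynomial `s_B` in the expansion of a
symmetric polynomial `P` in the basis of Schur polynomials of partitions of length at most
`l`: it equals the coefficient of the monomial `x ^ (B + δ)` in the alternating polynomial
`P * a_δ`, where `δ = (l-1, l-2, …, 0)`. -/
noncomputable def schurMult (l : ℕ) (B : Fin l → ℕ) (P : MvPolynomial (Fin l) ℤ) : ℤ :=
  MvPolynomial.coeff (Finsupp.equivFunOnFinite.symm fun i : Fin l => B i + (l - 1 - (i : ℕ)))
    (P * vdm l)

/-- The Littlewood–Richardson coefficient `c^C_{A,B}` for partitions of length at most `l`,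
as the multiplicity of `s_C` in `s_A * s_B` (this agrees with the structure constants of the
ring of symmetric functions in the Schur basis). -/
noncomputable def lrCoeff (l : ℕ) (A B C : Fin l → ℕ) : ℤ :=
  schurMult l C (schur l A * schur l B)

/-- Dominance: every partial sum of `A` is at least the corresponding partial sum of `B`. -/
def Dom (l : ℕ) (A B : Fin l → ℕ) : Prop :=
  ∀ r : ℕ, ∑ i ∈ Finset.univ.filter (fun i : Fin l => (i : ℕ) < r), B i ≤
    ∑ i ∈ Finset.univ.filter (fun i : Fin l => (i : ℕ) < r), A i

/-- The Young diagram of `A` (0-based): boxes `(i, j)` with `j < A i`. -/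
def YD (l : ℕ) (A : Fin l → ℕ) : Set (Fin l × ℕ) := {p | p.2 < A p.1}

/-- Size of block `I_j` of the subdivision of `{1,…,l}` encoded by the monotone
surjection `f : Fin l → Fin ι` (whose fibers are the consecutive blocks). -/
def bsize (l ι : ℕ) (f : Fin l → Fin ι) (j : Fin ι) : ℕ :=
  (Finset.univ.filter fun i => f i = j).card

/-- The first (0-based) position of block `I_j`. -/
def bstart (l ι : ℕ) (f : Fin l → Fin ι) (j : Fin ι) : ℕ :=
  (Finset.univ.filter fun i => f i < j).card

/-- One past the last (0-based) position of block `I_j`. -/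
def bend (l ι : ℕ) (f : Fin l → Fin ι) (j : Fin ι) : ℕ :=
  (Finset.univ.filter fun i => f i ≤ j).card

/-- The sum `|A[I_j]|` of the entries of `A` over block `I_j`. -/
def bsum (l ι : ℕ) (f : Fin l → Fin ι) (A : Fin l → ℕ) (j : Fin ι) : ℕ :=
  ∑ i ∈ Finset.univ.filter (fun i => f i = j), A i

/-- `L(l) = lcm {1, …, l}`. -/
def Lnum (l : ℕ) : ℕ := (Finset.Icc 1 l).lcm id

/-- The partition `G_J(A)`: constant on each block `I_j`, with value `(L(l)/|I_j|)·|A[I_j]|`. -/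
def GJ (l ι : ℕ) (f : Fin l → Fin ι) (A : Fin l → ℕ) : Fin l → ℕ :=
  fun i => (Lnum l / bsize l ι f (f i)) * bsum l ι f A (f i)

/-- `A` extended by zero beyond its `l` entries. -/
def pad (l : ℕ) (A : Fin l → ℕ) (m : ℕ) : ℕ := if h : m < l then A ⟨m, h⟩ else 0

/-- The position symmetric to `i` within its block (reversal of the block). -/
def reflIdx (l ι : ℕ) (f : Fin l → Fin ι) (i : Fin l) : ℕ :=
  bstart l ι f (f i) + bend l ι f (f i) - 1 - (i : ℕ)

/-- `χ_J(A)`: on each block, the negatives of the entries of `A` in reversed order. -/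
def chiJ (l ι : ℕ) (f : Fin l → Fin ι) (A : Fin l → ℕ) : Fin l → ℤ :=
  fun i => -(pad l A (reflIdx l ι f i) : ℤ)

/-- `H_J(A,m,n) = G_J(A) + E_J(m) + F_J(n)`: subtract `1` at the last position of block
`I_m` and add `1` at the first position of block `I_n`. -/
def HJ (l ι : ℕ) (f : Fin l → Fin ι) (A : Fin l → ℕ) (m n : Fin ι) : Fin l → ℤ :=
  fun i => (GJ l ι f A i : ℤ) - (if (i : ℕ) = bend l ι f m - 1 then 1 else 0)
    + (if (i : ℕ) = bstart l ι f n then 1 else 0)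

/-- The length `ã_j = #{i : a_i ≥ j}` of the `j`-th column of `A` (`j` is 1-based). -/
def colLen (l : ℕ) (A : Fin l → ℕ) (j : ℕ) : ℕ :=
  (Finset.univ.filter fun i => j ≤ A i).card

theorem colLen_le (l : ℕ) (A : Fin l → ℕ) (j : ℕ) : colLen l A j ≤ l :=
  le_trans (Finset.card_filter_le _ _) (by simp)


/-! ### Column tableaux -/

/-- number of elements of `S` below `i` -/
def lrCnt {l : ℕ} (S : Finset (Fin l)) (i : ℕ) : ℕ := (S.filter (fun x => x.val < i)).card

/-- columnwise comparison: `S'` may stand to the left of `S`. -/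
def lrLe {l : ℕ} (S' S : Finset (Fin l)) : Prop := ∀ i : ℕ, lrCnt S i ≤ lrCnt S' i

open Classical in
/-- generating function of column tableaux, columns listed from right to left,
with a column `S` standing at the right. -/
noncomputable def lrP (l : ℕ) : List ℕ → Finset (Fin l) → MvPolynomial (Fin l) ℤ
  | [], _ => 1
  | c :: cs, S => ∑ S' : Finset (Fin l),
      if S'.card = c ∧ lrLe S' S then (∏ i ∈ S', X i) * lrP l cs S' else 0

theorem lrCnt_insert {l : ℕ} (S : Finset (Fin l)) (a : Fin l) (ha : a ∉ S) (i : ℕ) :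
    lrCnt (insert a S) i = lrCnt S i + if a.val < i then 1 else 0 := by
  unfold lrCnt
  rw [Finset.filter_insert]
  split_ifs with h
  · rw [Finset.card_insert_of_notMem (by simp [ha])]
  · rfl

theorem lrCnt_succ {l : ℕ} (S : Finset (Fin l)) (a : Fin l) (ha : a ∉ S) :
    lrCnt S (a.val + 1) = lrCnt S a.val := by
  unfold lrCnt
  congr 1
  ext x
  simp only [Finset.mem_filter, and_congr_right_iff]
  intro hx
  have : x.val ≠ a.val := fun h => ha (Fin.ext h ▸ hx)
  omega

theorem lrCnt_succ_mem {l : ℕ} (S : Finset (Fin l)) (a : Fin l) (ha : a ∈ S) :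
    lrCnt S (a.val + 1) = lrCnt S a.val + 1 := by
  have h := lrCnt_insert (S.erase a) a (by simp) (a.val + 1)
  have h' := lrCnt_insert (S.erase a) a (by simp) (a.val)
  rw [Finset.insert_erase ha] at h h'
  have h2 := lrCnt_succ (S.erase a) a (by simp)
  simp at h h'
  omega

theorem lrSum_split {l : ℕ} (a b : Fin l) (hab : a ≠ b)
    (g : Finset (Fin l) → MvPolynomial (Fin l) ℤ) :
    ∑ S : Finset (Fin l), g S = ∑ Q ∈ ((univ.erase a).erase b).powerset,
      (g Q + g (insert a (insert b Q)) + (g (insert a Q) + g (insert b Q))) := by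
  have h1 : (univ : Finset (Finset (Fin l))) = (univ : Finset (Fin l)).powerset := by simp
  have h2 : (univ : Finset (Fin l)) = insert a (insert b ((univ.erase a).erase b)) := by
    rw [Finset.insert_erase (by simp [hab.symm]), Finset.insert_erase (by simp)]
  rw [h1]
  conv_lhs => rw [h2]
  rw [Finset.sum_powerset_insert (by simp [hab]), Finset.sum_powerset_insert (by simp),
    Finset.sum_powerset_insert (by simp)]
  rw [← Finset.sum_add_distrib, ← Finset.sum_add_distrib, ← Finset.sum_add_distrib]
  apply Finset.sum_congr rfl
  intros; ring

section adj
variable {l : ℕ} (a b : Fin l) (hab : b.val = a.val + 1)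

theorem lrLe_aa (Q R : Finset (Fin l)) (a : Fin l) (h1 : a ∉ Q) (h2 : a ∉ R) :
    lrLe (insert a Q) (insert a R) ↔ lrLe Q R := by
  unfold lrLe
  simp only [lrCnt_insert _ _ h1, lrCnt_insert _ _ h2, add_le_add_iff_right]

theorem lrLe_ba (Q R : Finset (Fin l)) (hab : b.val = a.val + 1)
    (h1 : a ∉ Q) (h2 : b ∉ Q) (h3 : a ∉ R) (h4 : b ∉ R) :
    lrLe (insert b Q) (insert a R) ↔ lrLe Q R ∧ lrCnt R a.val + 1 ≤ lrCnt Q a.val := by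
  unfold lrLe
  simp only [lrCnt_insert _ _ h2, lrCnt_insert _ _ h3]
  have e1 := lrCnt_succ Q a h1
  have e2 := lrCnt_succ R a h3
  constructor
  · intro h
    refine ⟨fun i => ?_, ?_⟩
    · have := h i
      split_ifs at this <;> omega
    · have := h (a.val + 1)
      simp [hab] at this
      omega
  · rintro ⟨h, h'⟩ i
    have := h i
    by_cases hi : i = a.val + 1
    · subst hi
      simp [hab]; omega
    · split_ifs <;> omega

theorem lrLe_ab (Q R : Finset (Fin l)) (hab : b.val = a.val + 1)
    (h1 : a ∉ Q) (h2 : b ∉ Q) (h3 : a ∉ R) (h4 : b ∉ R) :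
    lrLe (insert a Q) (insert b R) ↔ lrLe Q R := by
  unfold lrLe
  simp only [lrCnt_insert _ _ h1, lrCnt_insert _ _ h4]
  have e1 := lrCnt_succ Q a h1
  have e2 := lrCnt_succ R a h3
  constructor
  · intro h i
    have := h i
    by_cases hi : i = a.val + 1
    · subst hi
      have := h a.val
      simp [hab] at this; omega
    · split_ifs at this <;> omega
  · intro h i
    have := h i
    split_ifs <;> omega

theorem lrLe_0 (Q R : Finset (Fin l)) (hab : b.val = a.val + 1)
    (h1 : a ∉ Q) (h2 : b ∉ Q) (h3 : a ∉ R) (h4 : b ∉ R) :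
    lrLe Q (insert a R) ↔ lrLe Q (insert b R) := by
  unfold lrLe
  simp only [lrCnt_insert _ _ h3, lrCnt_insert _ _ h4]
  have e1 := lrCnt_succ Q a h1
  have e2 := lrCnt_succ R a h3
  have e1' := lrCnt_succ Q b h2
  have e2' := lrCnt_succ R b h4
  rw [hab] at e1' e2'
  constructor
  · intro h i
    have := h i
    split_ifs at this ⊢ <;> omega
  · intro h i
    have := h i
    have h' := h (a.val + 1 + 1)
    simp [hab] at h'
    by_cases hi : i = a.val + 1
    · subst hi; simp; omega
    · split_ifs at this ⊢ <;> omega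

theorem lrLe_2 (Q R : Finset (Fin l)) (hab : b.val = a.val + 1)
    (h1 : a ∉ Q) (h2 : b ∉ Q) (h3 : a ∉ R) (h4 : b ∉ R) :
    lrLe (insert a (insert b Q)) (insert a R) ↔ lrLe (insert a (insert b Q)) (insert b R) := by
  have hne : a ≠ b := by intro h; simp [h] at hab
  have h5 : a ∉ insert b Q := by simp [hne, h1]
  unfold lrLe
  simp only [lrCnt_insert _ _ h3, lrCnt_insert _ _ h4, lrCnt_insert _ _ h5, lrCnt_insert _ _ h2]
  have e1 := lrCnt_succ Q a h1
  have e2 := lrCnt_succ R a h3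
  have e1' := lrCnt_succ Q b h2
  have e2' := lrCnt_succ R b h4
  rw [hab] at e1' e2'
  constructor
  · intro h i
    have := h i
    split_ifs at this ⊢ <;> omega
  · intro h i
    have := h i
    have h' := h (a.val)
    simp [hab] at h'
    by_cases hi : i = a.val + 1
    · subst hi; simp; omega
    · split_ifs at this ⊢ <;> omega

/-- `a, b ∉ S` -/
theorem lrLe_s0 (Q R : Finset (Fin l)) (hab : b.val = a.val + 1)
    (h1 : a ∉ Q) (h2 : b ∉ Q) (h3 : a ∉ R) (h4 : b ∉ R) :
    lrLe (insert a Q) R ↔ lrLe (insert b Q) R := by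
  unfold lrLe
  simp only [lrCnt_insert _ _ h1, lrCnt_insert _ _ h2]
  have e1 := lrCnt_succ Q a h1
  have e2 := lrCnt_succ R a h3
  constructor
  · intro h i
    have := h i
    have h' := h (a.val)
    simp at h'
    by_cases hi : i = a.val + 1
    · subst hi; simp [hab]; omega
    · split_ifs at this ⊢ <;> omega
  · intro h i
    have := h i
    split_ifs at this ⊢ <;> omega

theorem lrLe_s2 (Q R : Finset (Fin l)) (hab : b.val = a.val + 1)
    (h1 : a ∉ Q) (h2 : b ∉ Q) (h3 : a ∉ R) (h4 : b ∉ R) :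
    lrLe (insert a Q) (insert a (insert b R)) ↔ lrLe (insert b Q) (insert a (insert b R)) := by
  have hne : a ≠ b := by intro h; simp [h] at hab
  have h5 : a ∉ insert b R := by simp [hne, h3]
  unfold lrLe
  simp only [lrCnt_insert _ _ h1, lrCnt_insert _ _ h2, lrCnt_insert _ _ h5, lrCnt_insert _ _ h4]
  have e1 := lrCnt_succ Q a h1
  have e2 := lrCnt_succ R a h3
  have e1' := lrCnt_succ Q b h2
  have e2' := lrCnt_succ R b h4
  rw [hab] at e1' e2'
  constructor
  · intro h i
    have := h i
    have h' := h (a.val + 1 + 1)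
    simp [hab] at h'
    by_cases hi : i = a.val + 1
    · subst hi; simp [hab]; omega
    · split_ifs at this ⊢ <;> omega
  · intro h i
    have := h i
    split_ifs at this ⊢ <;> omega

end adj

section key
variable {l : ℕ}

theorem lrP_key (a b : Fin l) (hab : b.val = a.val + 1) (cs : List ℕ) :
    (∀ S : Finset (Fin l), (a ∉ S ∨ b ∈ S) →
      rename (Equiv.swap a b) (lrP l cs S) = lrP l cs S) ∧
    (∀ R : Finset (Fin l), a ∉ R → b ∉ R →
      (X a - X b) * lrP l cs (insert b R) =
        X a * lrP l cs (insert a R) - X b * rename (Equiv.swap a b) (lrP l cs (insert a R))) := by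
  classical
  have hne : a ≠ b := by intro h; simp [h] at hab
  have hXne : (X a - X b : MvPolynomial (Fin l) ℤ) ≠ 0 := by
    rw [sub_ne_zero]
    exact fun h => hne (MvPolynomial.X_injective h)
  have hsX : ∀ Q : Finset (Fin l), a ∉ Q → b ∉ Q →
      rename (Equiv.swap a b) (∏ i ∈ Q, X i : MvPolynomial (Fin l) ℤ) = ∏ i ∈ Q, X i := by
    intro Q h1 h2
    rw [map_prod]
    apply Finset.prod_congr rfl
    intro i hi
    rw [rename_X, Equiv.swap_apply_of_ne_of_ne]
    · rintro rfl; exact h1 hi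
    · rintro rfl; exact h2 hi
  have hss : ∀ f : MvPolynomial (Fin l) ℤ,
      rename (Equiv.swap a b) (rename (Equiv.swap a b) f) = f := by
    intro f
    rw [rename_rename]
    have : (⇑(Equiv.swap a b) ∘ ⇑(Equiv.swap a b)) = id := by
      ext x; simp
    rw [this, rename_id_apply]
  have ha' : rename (Equiv.swap a b) (X a : MvPolynomial (Fin l) ℤ) = X b := by simp
  have hb' : rename (Equiv.swap a b) (X b : MvPolynomial (Fin l) ℤ) = X a := by simp
  induction cs with
  | nil =>
    refine ⟨fun S _ => by simp [lrP], fun R _ _ => by simp [lrP]⟩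
  | cons c cs ih =>
    obtain ⟨ihA, ihB⟩ := ih
    have hB : ∀ R : Finset (Fin l), a ∉ R → b ∉ R →
      (X a - X b) * lrP l (c :: cs) (insert b R) =
        X a * lrP l (c :: cs) (insert a R)
          - X b * rename (Equiv.swap a b) (lrP l (c :: cs) (insert a R)) := by
      intro R h3 h4
      simp only [lrP]
      rw [lrSum_split a b hne, lrSum_split a b hne, map_sum, Finset.mul_sum, Finset.mul_sum,
        Finset.mul_sum, ← Finset.sum_sub_distrib]
      apply Finset.sum_congr rfl
      intro Q hQ
      have h1 : a ∉ Q := fun h => by simpa using Finset.mem_powerset.1 hQ h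
      have h2 : b ∉ Q := fun h => by simpa using Finset.mem_powerset.1 hQ h
      have h5 : a ∉ insert b Q := by simp [hne, h1]
      have hc1 : (insert a Q).card = Q.card + 1 := by simp [h1]
      have hc2 : (insert b Q).card = Q.card + 1 := by simp [h2]
      obtain ⟨W, hW⟩ : ∃ W : Prop, W ↔ (lrLe Q R ∧ lrCnt R a.val + 1 ≤ lrCnt Q a.val) :=
        ⟨_, Iff.rfl⟩
      rw [lrLe_0 a b Q R hab h1 h2 h3 h4, lrLe_2 a b Q R hab h1 h2 h3 h4,
        lrLe_ba a b Q R hab h1 h2 h3 h4, ← hW, lrLe_ab a b Q R hab h1 h2 h3 h4,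
        lrLe_aa Q R a h1 h3, lrLe_aa Q R b h2 h4, hc1, hc2]
      rw [Finset.prod_insert h5, Finset.prod_insert h1, Finset.prod_insert h2]
      have i0 := ihA Q (Or.inl h1)
      have i2 := ihA (insert a (insert b Q)) (Or.inr (by simp))
      have ib := ihA (insert b Q) (Or.inr (by simp))
      have iB := ihB Q h1 h2
      have hQX := hsX Q h1 h2
      have E1 : ∀ p : Prop, [Decidable p] → ∀ u : MvPolynomial (Fin l) ℤ,
          rename (Equiv.swap a b) u = u →
          (X a - X b) * (if p then u else 0) = X a * (if p then u else 0)
          - X b * rename (Equiv.swap a b) (if p then u else 0) := by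
        intro p _ u hu
        split_ifs
        · rw [hu]; ring
        · simp
      have t0 := E1 (Q.card = c ∧ lrLe Q (insert b R)) ((∏ i ∈ Q, X i) * lrP l cs Q)
        (by rw [map_mul, hQX, i0])
      have t2 := E1 ((insert a (insert b Q)).card = c ∧ lrLe (insert a (insert b Q)) (insert b R))
        ((X a * (X b * ∏ i ∈ Q, X i)) * lrP l cs (insert a (insert b Q)))
        (by rw [map_mul, map_mul, map_mul, hQX, i2, ha', hb']; ring)
      have t1 : (X a - X b) * ((if Q.card + 1 = c ∧ lrLe Q R then
            (X a * ∏ i ∈ Q, X i) * lrP l cs (insert a Q) else 0) +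
            (if Q.card + 1 = c ∧ lrLe Q R then
            (X b * ∏ i ∈ Q, X i) * lrP l cs (insert b Q) else 0)) =
          X a * ((if Q.card + 1 = c ∧ lrLe Q R then
            (X a * ∏ i ∈ Q, X i) * lrP l cs (insert a Q) else 0) +
            (if Q.card + 1 = c ∧ W then
            (X b * ∏ i ∈ Q, X i) * lrP l cs (insert b Q) else 0))
          - X b * rename (Equiv.swap a b) ((if Q.card + 1 = c ∧ lrLe Q R then
            (X a * ∏ i ∈ Q, X i) * lrP l cs (insert a Q) else 0) +
            (if Q.card + 1 = c ∧ W then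
            (X b * ∏ i ∈ Q, X i) * lrP l cs (insert b Q) else 0)) := by
        by_cases p : Q.card + 1 = c ∧ lrLe Q R
        · by_cases q : lrCnt R a.val + 1 ≤ lrCnt Q a.val
          · rw [if_pos p, if_pos p, if_pos ⟨p.1, hW.2 ⟨p.2, q⟩⟩]
            simp only [map_add, map_mul, hQX, ha', hb', ib]
            linear_combination (X b * (∏ i ∈ Q, X i)) * iB
          · rw [if_pos p, if_pos p, if_neg (fun h => q (hW.1 h.2).2)]
            simp only [map_add, map_mul, hQX, ha', map_zero]
            linear_combination (X b * (∏ i ∈ Q, X i)) * iB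
        · rw [if_neg p, if_neg p, if_neg (fun h => p ⟨h.1, (hW.1 h.2).1⟩)]
          simp
      simp only [map_add] at t0 t1 t2 ⊢
      linear_combination t0 + t1 + t2
    refine ⟨?_, hB⟩
    -- symmetric summands
    have hgen : ∀ S : Finset (Fin l), (∀ Q : Finset (Fin l), a ∉ Q → b ∉ Q →
        (lrLe (insert a Q) S ↔ lrLe (insert b Q) S)) →
        rename (Equiv.swap a b) (lrP l (c :: cs) S) = lrP l (c :: cs) S := by
      intro S hS
      simp only [lrP]
      rw [lrSum_split a b hne, map_sum]
      apply Finset.sum_congr rfl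
      intro Q hQ
      have h1 : a ∉ Q := fun h => by simpa using Finset.mem_powerset.1 hQ h
      have h2 : b ∉ Q := fun h => by simpa using Finset.mem_powerset.1 hQ h
      have h5 : a ∉ insert b Q := by simp [hne, h1]
      have hc1 : (insert a Q).card = Q.card + 1 := by simp [h1]
      have hc2 : (insert b Q).card = Q.card + 1 := by simp [h2]
      rw [hS Q h1 h2, hc1, hc2]
      rw [Finset.prod_insert h5, Finset.prod_insert h1, Finset.prod_insert h2]
      have i0 := ihA Q (Or.inl h1)
      have i2 := ihA (insert a (insert b Q)) (Or.inr (by simp))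
      have ib := ihA (insert b Q) (Or.inr (by simp))
      have iB := ihB Q h1 h2
      have hQX := hsX Q h1 h2
      simp only [map_add]
      congr 1
      · congr 1
        · split_ifs
          · rw [map_mul, hQX, i0]
          · simp
        · split_ifs
          · rw [map_mul, map_mul, map_mul, hQX, i2, ha', hb']; ring
          · simp
      · split_ifs
        · simp only [map_mul, hQX, ha', hb', ib]
          linear_combination (∏ i ∈ Q, X i) * iB
        · simp
    intro S hS
    by_cases haS : a ∈ S
    · have hbS : b ∈ S := by tauto
      apply hgen
      intro Q h1 h2
      have : S = insert a (insert b ((S.erase a).erase b)) := by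
        rw [Finset.insert_erase (by simp [hne.symm, hbS]), Finset.insert_erase haS]
      rw [this]
      exact lrLe_s2 a b Q _ hab h1 h2 (by simp) (by simp)
    · by_cases hbS : b ∈ S
      · have hR := hB (S.erase b) (by simp [haS]) (by simp)
        rw [Finset.insert_erase hbS] at hR
        have hR2 := congrArg (rename (Equiv.swap a b)) hR
        simp only [map_mul, map_sub, ha', hb', hss] at hR2
        apply mul_left_cancel₀ hXne
        linear_combination -hR - hR2
      · apply hgen
        intro Q h1 h2
        exact lrLe_s0 a b Q _ hab h1 h2 haS hbS

theorem lrP_symm (cs : List ℕ) (σ : Equiv.Perm (Fin l)) :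
    rename σ (lrP l cs ∅) = lrP l cs ∅ := by
  cases l with
  | zero =>
    have : σ = 1 := Subsingleton.elim _ _
    subst this
    simp [Equiv.Perm.coe_one]
  | succ n =>
    have h : σ ∈ (⊤ : Submonoid (Equiv.Perm (Fin (n+1)))) := trivial
    rw [← Equiv.Perm.mclosure_swap_castSucc_succ] at h
    induction h using Submonoid.closure_induction with
    | mem x hx =>
      obtain ⟨i, rfl⟩ := hx
      exact (lrP_key i.castSucc i.succ (by simp) cs).1 ∅ (by simp)
    | one => simp [Equiv.Perm.coe_one]
    | mul x y _ _ hx hy =>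
      rw [Equiv.Perm.coe_mul, ← rename_rename, hy, hx]

end key

/-! ### Alternants and the Littlewood–Richardson expansion -/

section alt
variable {l : ℕ}

noncomputable def lrAlt (f : MvPolynomial (Fin l) ℤ) : MvPolynomial (Fin l) ℤ :=
  ∑ σ : Equiv.Perm (Fin l), ((Equiv.Perm.sign σ : ℤ) : MvPolynomial (Fin l) ℤ) * rename σ f

noncomputable def lrMon (μ : Fin l → ℕ) : MvPolynomial (Fin l) ℤ :=
  ∏ i : Fin l, X i ^ (μ i + (l - 1 - (i : ℕ)))

/-- indicator of a set -/
def lrInd (S : Finset (Fin l)) (i : Fin l) : ℕ := if i ∈ S then 1 else 0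

theorem lrAlt_sum {ι : Type*} (s : Finset ι) (f : ι → MvPolynomial (Fin l) ℤ) :
    lrAlt (∑ i ∈ s, f i) = ∑ i ∈ s, lrAlt (f i) := by
  unfold lrAlt
  simp only [map_sum, Finset.mul_sum]
  rw [Finset.sum_comm]

theorem lrAlt_mul_symm (P f : MvPolynomial (Fin l) ℤ)
    (hP : ∀ σ : Equiv.Perm (Fin l), rename σ P = P) : lrAlt (P * f) = P * lrAlt f := by
  unfold lrAlt
  rw [Finset.mul_sum]
  apply Finset.sum_congr rfl
  intro σ _
  rw [map_mul, hP]; ring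

theorem lrAlt_zero (f : MvPolynomial (Fin l) ℤ) (a b : Fin l) (hab : a ≠ b)
    (hf : rename (Equiv.swap a b) f = f) : lrAlt f = 0 := by
  have h : lrAlt f = - lrAlt f := by
    conv_lhs => unfold lrAlt
    rw [← Equiv.sum_comp (Equiv.mulRight (Equiv.swap a b))]
    unfold lrAlt
    rw [← Finset.sum_neg_distrib]
    apply Finset.sum_congr rfl
    intro σ _
    simp only [Equiv.coe_mulRight, Equiv.Perm.sign_mul, Equiv.Perm.sign_swap hab,
      Equiv.Perm.coe_mul]
    rw [← rename_rename, hf]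
    simp
  exact self_eq_neg.mp h

theorem vdm_eq : vdm l = lrAlt (lrMon 0) := by
  unfold vdm lrAlt lrMon
  rw [Matrix.det_apply']
  simp [map_prod]

theorem lrMon_eq (μ : Fin l → ℕ) : lrMon μ =
    monomial (Finsupp.equivFunOnFinite.symm fun i : Fin l => μ i + (l - 1 - (i : ℕ))) 1 := by
  unfold lrMon
  rw [monomial_eq, Finsupp.prod_fintype _ _ (by simp)]
  simp

theorem lr_strictAnti (μ : Fin l → ℕ) (hμ : Antitone μ) :
    StrictAnti (fun i : Fin l => μ i + (l - 1 - (i : ℕ))) := by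
  intro i j hij
  have := hμ hij.le
  have h1 : i.val < j.val := hij
  have := j.isLt
  simp only
  omega

theorem lrAlt_coeff (ν H : Fin l → ℕ) (hν : Antitone ν) (hH : Antitone H) :
    coeff (Finsupp.equivFunOnFinite.symm fun i : Fin l => H i + (l - 1 - (i : ℕ)))
      (lrAlt (lrMon ν)) = if ν = H then 1 else 0 := by
  classical
  unfold lrAlt
  rw [coeff_sum, Finset.sum_eq_single 1]
  · simp only [Equiv.Perm.sign_one, Units.val_one, Int.cast_one, one_mul, Equiv.Perm.coe_one,
      rename_id_apply]
    rw [lrMon_eq, coeff_monomial]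
    congr 1
    rw [Equiv.apply_eq_iff_eq]
    apply propext
    constructor
    · intro h
      ext i
      have := congrFun h i
      omega
    · rintro rfl; rfl
  · intro σ _ hσ
    rw [← map_intCast (C : ℤ →+* MvPolynomial (Fin l) ℤ), coeff_C_mul, lrMon_eq, rename_monomial,
      coeff_monomial, if_neg, mul_zero]
    intro h
    apply hσ
    have hs := lr_strictAnti ν hν
    have ht := lr_strictAnti H hH
    have e : ∀ i : Fin l, ν i + (l - 1 - (i : ℕ)) = H (σ i) + (l - 1 - ((σ i : Fin l) : ℕ)) := by
      intro i
      have := DFunLike.congr_fun h (σ i)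
      rw [Finsupp.mapDomain_apply σ.injective] at this
      simpa using this
    have hmono : StrictMono σ := by
      intro i j hij
      have := hs hij
      simp only [e] at this
      exact ht.lt_iff_gt.1 this
    ext i
    have := (hmono.range_inj strictMono_id).1 (by simp)
    rw [this]; rfl
  · simp

theorem lrMon_mul (μ : Fin l → ℕ) (S : Finset (Fin l)) :
    lrMon μ * (∏ i ∈ S, X i) = lrMon (μ + lrInd S) := by
  have : (∏ i ∈ S, X i : MvPolynomial (Fin l) ℤ) = ∏ i : Fin l, X i ^ (lrInd S i) := by
    simp [lrInd, Finset.prod_ite_mem]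
  rw [this]
  unfold lrMon
  rw [← Finset.prod_mul_distrib]
  apply Finset.prod_congr rfl
  intro i _
  rw [← pow_add]
  congr 1
  simp only [Pi.add_apply]
  omega

theorem lr_not_antitone (μ : Fin l → ℕ) (h : ¬ Antitone μ) :
    ∃ a b : Fin l, b.val = a.val + 1 ∧ μ a < μ b := by
  cases l with
  | zero => exact absurd (fun i => i.elim0) h
  | succ n =>
    rw [Fin.antitone_iff_succ_le] at h
    push Not at h
    obtain ⟨i, hi⟩ := h
    exact ⟨i.castSucc, i.succ, by simp, hi⟩

open Classical in
theorem lrAlt_cons (μ : Fin l → ℕ) (hμ : Antitone μ) (c : ℕ) (cs : List ℕ)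
    (S : Finset (Fin l)) :
    lrAlt (lrMon μ * lrP l (c :: cs) S) = ∑ S' : Finset (Fin l),
      if S'.card = c ∧ lrLe S' S ∧ Antitone (μ + lrInd S') then
        lrAlt (lrMon (μ + lrInd S') * lrP l cs S') else 0 := by
  simp only [lrP]
  rw [Finset.mul_sum, lrAlt_sum]
  apply Finset.sum_congr rfl
  intro S' _
  by_cases p : S'.card = c ∧ lrLe S' S
  · rw [if_pos p, ← mul_assoc, lrMon_mul]
    by_cases q : Antitone (μ + lrInd S')
    · rw [if_pos ⟨p.1, p.2, q⟩]
    · rw [if_neg (fun h => q h.2.2)]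
      obtain ⟨a, b, hab, hlt⟩ := lr_not_antitone _ q
      have hne : a ≠ b := by intro h; simp [h] at hab
      have hle : μ b ≤ μ a := hμ (by rw [Fin.le_def]; omega)
      have haS : a ∉ S' := by
        intro h
        simp only [Pi.add_apply, lrInd, if_pos h] at hlt
        split_ifs at hlt <;> omega
      have hbS : b ∈ S' := by
        by_contra h
        simp only [Pi.add_apply, lrInd, if_neg h] at hlt
        omega
      simp only [Pi.add_apply, lrInd, if_neg haS, if_pos hbS] at hlt
      apply lrAlt_zero _ a b hne
      rw [map_mul, (lrP_key a b hab cs).1 S' (Or.inl haS)]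
      congr 1
      unfold lrMon
      rw [map_prod, ← Equiv.prod_comp (Equiv.swap a b)]
      apply Finset.prod_congr rfl
      intro i _
      rw [map_pow, rename_X, Equiv.swap_apply_self]
      congr 1
      have hb := b.isLt
      have e : μ b + 1 + (l - 1 - b.val) = μ a + 0 + (l - 1 - a.val) := by omega
      by_cases hia : i = a
      · subst hia
        simp only [Equiv.swap_apply_left, Pi.add_apply, lrInd, if_neg haS, if_pos hbS, e]
      · by_cases hib : i = b
        · subst hib
          simp only [Equiv.swap_apply_right, Pi.add_apply, lrInd, if_neg haS, if_pos hbS, e]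
        · rw [Equiv.swap_apply_of_ne_of_ne hia hib]
  · rw [if_neg p, if_neg (fun h => p ⟨h.1, h.2.1⟩), mul_zero]
    simp [lrAlt]

/-- nonnegative combinations of alternants -/
noncomputable def lrCone (l : ℕ) : AddSubmonoid (MvPolynomial (Fin l) ℤ) :=
  AddSubmonoid.closure {f | ∃ ν : Fin l → ℕ, Antitone ν ∧ f = lrAlt (lrMon ν)}

theorem lrCone_coeff (f : MvPolynomial (Fin l) ℤ) (hf : f ∈ lrCone l) (H : Fin l → ℕ)
    (hH : Antitone H) :
    0 ≤ coeff (Finsupp.equivFunOnFinite.symm fun i : Fin l => H i + (l - 1 - (i : ℕ))) f := by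
  classical
  induction hf using AddSubmonoid.closure_induction with
  | mem x hx =>
    obtain ⟨ν, hν, rfl⟩ := hx
    rw [lrAlt_coeff ν H hν hH]
    split_ifs <;> simp
  | zero => simp
  | add x y _ _ hx hy => rw [coeff_add]; exact add_nonneg hx hy

theorem lrAlt_mem_cone (cs : List ℕ) : ∀ (μ : Fin l → ℕ) (S : Finset (Fin l)), Antitone μ →
    lrAlt (lrMon μ * lrP l cs S) ∈ lrCone l := by
  classical
  induction cs with
  | nil =>
    intro μ S hμ
    simp only [lrP, mul_one]
    exact AddSubmonoid.subset_closure ⟨μ, hμ, rfl⟩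
  | cons c cs ih =>
    intro μ S hμ
    rw [lrAlt_cons μ hμ]
    apply AddSubmonoid.sum_mem
    intro S' _
    split_ifs with h
    · exact ih _ _ h.2.2
    · exact AddSubmonoid.zero_mem _

/-- chains of columns with dominant running weight -/
def lrReach : List ℕ → Finset (Fin l) → (Fin l → ℕ) → (Fin l → ℕ) → Prop
  | [], _, μ, ν => μ = ν
  | c :: cs, S, μ, ν => ∃ S' : Finset (Fin l), S'.card = c ∧ lrLe S' S ∧
      Antitone (μ + lrInd S') ∧ lrReach cs S' (μ + lrInd S') ν

theorem lrReach_alt (cs : List ℕ) : ∀ (μ ν : Fin l → ℕ) (S : Finset (Fin l)), Antitone μ →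
    lrReach cs S μ ν → ∃ g ∈ lrCone l, lrAlt (lrMon μ * lrP l cs S) = lrAlt (lrMon ν) + g := by
  classical
  induction cs with
  | nil =>
    intro μ ν S hμ h
    simp only [lrReach] at h
    subst h
    exact ⟨0, AddSubmonoid.zero_mem _, by simp [lrP]⟩
  | cons c cs ih =>
    rintro μ ν S hμ ⟨S', h1, h2, h3, h4⟩
    obtain ⟨g, hg, e⟩ := ih _ _ _ h3 h4
    rw [lrAlt_cons μ hμ, ← Finset.add_sum_erase _ _ (Finset.mem_univ S'), if_pos ⟨h1, h2, h3⟩, e,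
      add_assoc]
    refine ⟨_, AddSubmonoid.add_mem _ hg ?_, rfl⟩
    apply AddSubmonoid.sum_mem
    intro S'' _
    split_ifs with h
    · exact lrAlt_mem_cone _ _ _ h.2.2
    · exact AddSubmonoid.zero_mem _

theorem lrP_mul_cone (cs : List ℕ) (f : MvPolynomial (Fin l) ℤ) (hf : f ∈ lrCone l) :
    lrP l cs ∅ * f ∈ lrCone l := by
  induction hf using AddSubmonoid.closure_induction with
  | mem x hx =>
    obtain ⟨ν, hν, rfl⟩ := hx
    rw [← lrAlt_mul_symm _ _ (lrP_symm cs), mul_comm]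
    exact lrAlt_mem_cone _ _ _ hν
  | zero => simp
  | add x y _ _ hx hy => rw [mul_add]; exact AddSubmonoid.add_mem _ hx hy

/-- positivity criterion -/
theorem lr_pos (cs : List ℕ) (L : ℕ) (M : ℕ → Fin l → ℕ) (hM0 : M 0 = 0)
    (hM : ∀ t, t ≤ L → Antitone (M t)) (hR : ∀ t, t < L → lrReach cs ∅ (M t) (M (t + 1))) :
    0 < schurMult l (M L) (lrP l cs ∅ ^ L) := by
  have key : ∀ t, t ≤ L → ∃ g ∈ lrCone l, lrP l cs ∅ ^ t * vdm l = lrAlt (lrMon (M t)) + g := by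
    intro t
    induction t with
    | zero => 
      intro _
      exact ⟨0, AddSubmonoid.zero_mem _, by rw [vdm_eq, hM0]; simp⟩
    | succ t ih =>
      intro ht
      obtain ⟨g, hg, e⟩ := ih (by omega)
      obtain ⟨g', hg', e'⟩ := lrReach_alt cs (M t) (M (t+1)) ∅ (hM t (by omega)) (hR t (by omega))
      rw [mul_comm, lrAlt_mul_symm _ _ (lrP_symm cs)] at e'
      refine ⟨g' + lrP l cs ∅ * g, AddSubmonoid.add_mem _ hg' (lrP_mul_cone cs g hg), ?_⟩
      rw [pow_succ', mul_assoc, e, mul_add, e', add_assoc]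
  obtain ⟨g, hg, e⟩ := key L le_rfl
  unfold schurMult
  rw [e, coeff_add, lrAlt_coeff _ _ (hM L le_rfl) (hM L le_rfl), if_pos rfl]
  have := lrCone_coeff g hg (M L) (hM L le_rfl)
  omega

end alt

/-! ### Jacobi–Trudi and the bialternant formula -/

section jt
variable {l : ℕ}

theorem lr_hsymm_eq (n : ℕ) : hsymm (Fin l) ℤ n =
    ∑ d ∈ (univ : Finset (Fin l)).finsuppAntidiag n, ∏ i : Fin l, (X i : MvPolynomial (Fin l) ℤ) ^ d i := by
  classical
  unfold hsymm
  refine Finset.sum_bij (fun s _ => Multiset.toFinsupp s.1) ?_ ?_ ?_ ?_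
  · intro s _
    rw [Finset.mem_finsuppAntidiag]
    refine ⟨?_, by simp⟩
    have := Multiset.toFinsupp_sum_eq s.1
    rw [Finsupp.sum_fintype _ _ (by simp)] at this
    exact this.trans s.2
  · intro s _ s' _ h
    exact Subtype.ext (Multiset.toFinsupp.injective h)
  · intro d hd
    rw [Finset.mem_finsuppAntidiag] at hd
    refine ⟨⟨Finsupp.toMultiset d, ?_⟩, mem_univ _, by simp⟩
    rw [Finsupp.card_toMultiset, Finsupp.sum_fintype _ _ (by simp)]
    exact hd.1
  · intro s _
    rw [Finset.prod_multiset_map_count]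
    simp only [Multiset.toFinsupp_apply]
    apply Finset.prod_subset (Finset.subset_univ _)
    intro x _ hx
    rw [Multiset.count_eq_zero_of_notMem (by simpa using hx), pow_zero]

/-- generating function of complete symmetric polynomials -/
theorem lr_gen : (PowerSeries.mk fun n => hsymm (Fin l) ℤ n) =
    ∏ i : Fin l, PowerSeries.mk fun n => (X i : MvPolynomial (Fin l) ℤ) ^ n := by
  classical
  ext1 n
  rw [PowerSeries.coeff_mk, PowerSeries.coeff_prod, lr_hsymm_eq]
  simp

theorem lr_geom (i : Fin l) : (1 - PowerSeries.C (X i : MvPolynomial (Fin l) ℤ) * PowerSeries.X) *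
    (PowerSeries.mk fun n => (X i : MvPolynomial (Fin l) ℤ) ^ n) = 1 := by
  ext1 n
  rw [sub_mul, one_mul, mul_assoc, map_sub, PowerSeries.coeff_C_mul]
  cases n with
  | zero => simp
  | succ n => 
    rw [PowerSeries.coeff_succ_X_mul, PowerSeries.coeff_mk, PowerSeries.coeff_mk,
      PowerSeries.coeff_one]
    simp [pow_succ']

/-- the polynomial `∏_{i ≠ k} (1 - x_i t)` -/
noncomputable def lrE (k : Fin l) : Polynomial (MvPolynomial (Fin l) ℤ) :=
  ∏ i ∈ univ.erase k, (1 - Polynomial.C (X i : MvPolynomial (Fin l) ℤ) * Polynomial.X)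

theorem lrE_coeff_zero (k : Fin l) (r : ℕ) (hr : l ≤ r) : (lrE k).coeff r = 0 := by
  apply Polynomial.coeff_eq_zero_of_natDegree_lt
  have h1 : (lrE k).natDegree ≤ ∑ i ∈ univ.erase k, 1 := by
    unfold lrE
    refine (Polynomial.natDegree_prod_le _ _).trans (Finset.sum_le_sum ?_)
    intro i _
    refine (Polynomial.natDegree_sub_le _ _).trans ?_
    simp only [Polynomial.natDegree_one, zero_le, sup_of_le_right]
    exact (Polynomial.natDegree_C_mul_le _ _).trans Polynomial.natDegree_X_le
  have h2 : ∑ i ∈ univ.erase k, 1 = l - 1 := by simp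
  have := k.isLt
  omega

theorem lr_pow_eq (k : Fin l) (α : ℕ) : (X k : MvPolynomial (Fin l) ℤ) ^ α =
    ∑ j : Fin l, (lrE k).coeff (l - 1 - j.val) * hp l ((α : ℤ) - ((l - 1 - j.val : ℕ) : ℤ)) := by
  classical
  have h : ((lrE k : Polynomial _) : PowerSeries (MvPolynomial (Fin l) ℤ)) *
      (PowerSeries.mk fun n => hsymm (Fin l) ℤ n) =
      PowerSeries.mk fun n => (X k : MvPolynomial (Fin l) ℤ) ^ n := by
    rw [lr_gen, ← Finset.mul_prod_erase univ _ (mem_univ k)]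
    unfold lrE
    rw [← Polynomial.coeToPowerSeries.ringHom_apply, map_prod, mul_left_comm,
      ← Finset.prod_mul_distrib]
    rw [Finset.prod_eq_one, mul_one]
    intro i _
    rw [Polynomial.coeToPowerSeries.ringHom_apply, ← lr_geom i]
    simp
  have h2 := congrArg (PowerSeries.coeff α) h
  rw [PowerSeries.coeff_mul, PowerSeries.coeff_mk, Finset.Nat.sum_antidiagonal_eq_sum_range_succ_mk]
    at h2
  rw [← h2]
  rw [Finset.sum_fin_eq_sum_range]
  have e1 : ∀ j ∈ range l, (if h : j < l then (lrE k).coeff (l - 1 - j) *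
      hp l ((α : ℤ) - ((l - 1 - j : ℕ) : ℤ)) else 0) = (fun r => (lrE k).coeff r *
      hp l ((α : ℤ) - (r : ℤ))) (l - 1 - j) := by
    intro j hj
    rw [dif_pos (Finset.mem_range.1 hj)]
  rw [Finset.sum_congr rfl e1, Finset.sum_range_reflect (fun r => (lrE k).coeff r *
      hp l ((α : ℤ) - (r : ℤ))) l]
  have e2 : ∀ N, l ≤ N → ∑ r ∈ range l, (lrE k).coeff r * hp l ((α : ℤ) - (r : ℤ)) =
      ∑ r ∈ range N, (lrE k).coeff r * hp l ((α : ℤ) - (r : ℤ)) := by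
    intro N hN
    apply Finset.sum_subset (Finset.range_mono hN)
    intro r _ hr
    rw [lrE_coeff_zero k r (by simpa using hr), zero_mul]
  rw [e2 (l + (α + 1)) (by omega)]
  symm
  rw [← Finset.sum_subset (Finset.range_mono (show α + 1 ≤ l + (α + 1) by omega))]
  · apply Finset.sum_congr rfl
    intro r hr
    have : r < α + 1 := Finset.mem_range.1 hr
    simp only [Polynomial.coeff_coe, PowerSeries.coeff_mk]
    unfold hp
    rw [if_pos (by omega)]
    congr 2
    omega
  · intro r _ hr
    have : ¬ r < α + 1 := by simpa using hr
    unfold hp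
    rw [if_neg (by omega), mul_zero]

theorem lr_alt_det (A : Fin l → ℕ) : lrAlt (lrMon A) =
    Matrix.det (Matrix.of fun k j : Fin l => (lrE k).coeff (l - 1 - j.val)) * schur l A := by
  unfold schur
  rw [← Matrix.det_transpose (Matrix.of fun i j : Fin l => hp l ((A i : ℤ) + (j : ℕ) - (i : ℕ))),
    ← Matrix.det_mul]
  unfold lrAlt lrMon
  rw [Matrix.det_apply']
  apply Finset.sum_congr rfl
  intro σ _
  congr 1
  rw [map_prod]
  apply Finset.prod_congr rfl
  intro i _
  rw [map_pow, rename_X, lr_pow_eq, Matrix.mul_apply]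
  apply Finset.sum_congr rfl
  intro j _
  simp only [Matrix.of_apply, Matrix.transpose_apply]
  congr 2
  have := i.isLt
  have := j.isLt
  omega

theorem schur_zero : schur l (0 : Fin l → ℕ) = 1 := by
  unfold schur
  rw [Matrix.det_of_isUpperTriangular]
  · apply Finset.prod_eq_one
    intro i _
    simp [hp]
  · intro i j hij
    have : j.val < i.val := hij
    simp only [Matrix.of_apply, hp]
    rw [if_neg]
    simp; omega

theorem lr_bialt (A : Fin l → ℕ) : lrAlt (lrMon A) = vdm l * schur l A := by
  rw [vdm_eq, lr_alt_det A, lr_alt_det 0, schur_zero, mul_one]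

theorem vdm_ne_zero : vdm l ≠ 0 := by
  intro h
  have := lrAlt_coeff (0 : Fin l → ℕ) 0 (fun _ _ _ => le_rfl) (fun _ _ _ => le_rfl)
  rw [← vdm_eq, h] at this
  simp at this

theorem lrCnt_le (S : Finset (Fin l)) (i : ℕ) : lrCnt S i ≤ i := by
  unfold lrCnt
  calc _ ≤ (Finset.range i).card := by
        apply Finset.card_le_card_of_injOn (fun x => x.val)
        · intro x hx; simp at hx ⊢; exact hx.2
        · intro x _ y _ h; exact Fin.ext h
    _ = i := by simp

/-- initial segment -/
def lrSeg (l s : ℕ) : Finset (Fin l) := univ.filter (fun i => i.val < s)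

theorem lrSeg_cnt (s i : ℕ) (hs : s ≤ l) : lrCnt (lrSeg l s) i = min s i := by
  unfold lrCnt lrSeg
  rw [Finset.filter_filter]
  have : (univ.filter (fun x : Fin l => x.val < s ∧ x.val < i)).map Fin.valEmbedding
      = Finset.range (min s i) := by
    ext x
    simp only [Finset.mem_map, Finset.mem_filter, Finset.mem_univ, true_and, Fin.valEmbedding_apply,
      Finset.mem_range, lt_inf_iff]
    constructor
    · rintro ⟨y, hy, rfl⟩; exact hy
    · intro h; exact ⟨⟨x, by omega⟩, h, rfl⟩
  rw [← Finset.card_map Fin.valEmbedding, this, Finset.card_range]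

theorem lrCnt_top (S : Finset (Fin l)) : lrCnt S l = S.card := by
  unfold lrCnt
  congr 1
  ext x; simp

theorem lr_initial (S : Finset (Fin l)) (h : ∀ a b : Fin l, a ≤ b → b ∈ S → a ∈ S) :
    S = lrSeg l S.card := by
  have hc : S.card ≤ l := by simpa using Finset.card_le_univ S
  apply Finset.eq_of_subset_of_card_le
  · intro x hx
    simp only [lrSeg, Finset.mem_filter, Finset.mem_univ, true_and]
    have h1 : univ.filter (fun y : Fin l => y ≤ x) ⊆ S := by
      intro y hy
      simp at hy
      exact h y x hy hx
    have h2 := Finset.card_le_card h1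
    have h3 : (univ.filter (fun y : Fin l => y ≤ x)).card = x.val + 1 := by
      have := Fin.card_Iic x
      rw [← this]; congr 1; ext; simp
    omega
  · have := lrSeg_cnt S.card l hc
    rw [lrCnt_top] at this
    omega

theorem lr_unique (cs : List ℕ) : ∀ (μ : Fin l → ℕ) (s : ℕ), s ≤ l → Antitone μ →
    (∀ i : Fin l, s ≤ i.val → μ i = 0) → (s :: cs).SortedLE → (∀ c ∈ cs, c ≤ l) →
    lrAlt (lrMon μ * lrP l cs (lrSeg l s)) =
      lrAlt (lrMon (fun i => μ i + (cs.filter (fun c => i.val < c)).length)) := by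
  classical
  induction cs with
  | nil => intro μ s _ _ _ _ _; simp [lrP]
  | cons c cs ih =>
    intro μ s hs hμ hz hsort hcl
    have hsc : s ≤ c := by
      have := hsort.pairwise
      simp at this
      exact this.1.1
    have hc : c ≤ l := hcl c (by simp)
    rw [lrAlt_cons μ hμ, Finset.sum_eq_single (lrSeg l c)]
    · have hA : Antitone (μ + lrInd (lrSeg l c)) := by
        apply hμ.add
        intro i j hij
        have : i.val ≤ j.val := hij
        unfold lrInd lrSeg
        simp only [Finset.mem_filter, Finset.mem_univ, true_and]
        split_ifs <;> omega
      rw [if_pos]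
      · rw [ih _ c hc hA]
        · congr 2
          ext i
          simp only [Pi.add_apply, lrInd, lrSeg, Finset.mem_filter, Finset.mem_univ, true_and,
            List.filter_cons, decide_eq_true_eq]
          split_ifs <;> simp <;> omega
        · intro i hi
          have := hz i (by omega)
          simp only [Pi.add_apply, lrInd, lrSeg, Finset.mem_filter, Finset.mem_univ, true_and]
          rw [if_neg (by omega)]; omega
        · have := hsort.pairwise
          exact (List.Pairwise.of_cons this).sortedLE
        · intro c' hc'; exact hcl c' (by simp [hc'])
      · refine ⟨?_, ?_, hA⟩
        · rw [← lrCnt_top, lrSeg_cnt c l hc]; omega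
        · intro i
          rw [lrSeg_cnt c i hc, lrSeg_cnt s i hs]; omega
    · intro S' _ hS'
      rw [if_neg]
      rintro ⟨h1, h2, h3⟩
      apply hS'
      rw [← h1]
      apply lr_initial
      intro a b hab hb
      by_contra ha
      have hab' : a.val ≤ b.val := hab
      -- a < s impossible
      by_cases has : a.val < s
      · have e1 := h2 (a.val + 1)
        rw [lrSeg_cnt s _ hs, lrCnt_succ S' a ha] at e1
        have := lrCnt_le S' a.val
        omega
      · have e := h3 hab
        simp only [Pi.add_apply, lrInd, if_pos hb, if_neg ha] at e
        have := hz a (by omega)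
        omega
    · simp

theorem lr_schur_eq (cs : List ℕ) (hsort : cs.SortedLE) (hcl : ∀ c ∈ cs, c ≤ l)
    (A : Fin l → ℕ) (hA : ∀ i : Fin l, A i = (cs.filter (fun c => i.val < c)).length) :
    schur l A = lrP l cs ∅ := by
  apply mul_left_cancel₀ (vdm_ne_zero (l := l))
  rw [← lr_bialt, vdm_eq, mul_comm, ← lrAlt_mul_symm _ _ (lrP_symm cs), mul_comm]
  have h0 : (∅ : Finset (Fin l)) = lrSeg l 0 := by ext; simp [lrSeg]
  have := lr_unique (l := l) cs 0 0 (by omega) (fun _ _ _ => le_rfl) (by simp) ?_ hcl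
  · rw [h0, this]
    congr 2
    ext i
    simp [hA i]
  · have := hsort.pairwise
    apply List.Pairwise.sortedLE
    simp [this]

end jt

/-! ### Superposition of column chains -/

section merge
variable {l : ℕ}

theorem lrReach_of_seq (N : ℕ) : ∀ (Z : ℕ → Finset (Fin l)) (μ : Fin l → ℕ),
    (∀ k < N, lrLe (Z (k + 1)) (Z k)) →
    (∀ k < N, Antitone (μ + ∑ k' ∈ range (k + 1), lrInd (Z (k' + 1)))) →
    lrReach ((List.range N).map (fun k => (Z (k + 1)).card)) (Z 0) μ
      (μ + ∑ k' ∈ range N, lrInd (Z (k' + 1))) := by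
  induction N with
  | zero => intro Z μ _ _; simp [lrReach]
  | succ N ih =>
    intro Z μ h1 h2
    rw [List.range_succ_eq_map]
    simp only [List.map_cons, List.map_map]
    refine ⟨Z 1, rfl, h1 0 (by omega), ?_, ?_⟩
    · have := h2 0 (by omega)
      simpa using this
    · have := ih (fun k => Z (k + 1)) (μ + lrInd (Z 1)) (fun k hk => h1 (k + 1) (by omega)) ?_
      · have e : μ + ∑ k' ∈ range (N + 1), lrInd (Z (k' + 1))
            = μ + lrInd (Z 1) + ∑ k' ∈ range N, lrInd (Z (k' + 1 + 1)) := by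
          rw [Finset.sum_range_succ']; simp only [zero_add]; abel
        rw [e]
        exact this
      · intro k hk
        have := h2 (k + 1) (by omega)
        have e : μ + ∑ k' ∈ range (k + 1 + 1), lrInd (Z (k' + 1))
            = μ + lrInd (Z 1) + ∑ k' ∈ range (k + 1), lrInd (Z (k' + 1 + 1)) := by
          rw [Finset.sum_range_succ']; simp only [zero_add]; abel
        rw [e] at this
        exact this

/-- the `k`-th smallest among the values `v j` (all at most `l`) -/
def lrZ (l N : ℕ) (v : Fin N → ℕ) (k : ℕ) : ℕ :=
  ((range l).filter (fun r => N < k + (univ.filter (fun j : Fin N => r < v j)).card)).card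

/-- list of the values `v j` in increasing order -/
def lrCs (l N : ℕ) (v : Fin N → ℕ) : List ℕ := (List.range N).map (fun k => lrZ l N v (k + 1))

theorem lrZ_mono (l N : ℕ) (v w : Fin N → ℕ) (h : v ≤ w) (k : ℕ) : lrZ l N v k ≤ lrZ l N w k := by
  unfold lrZ
  apply Finset.card_le_card
  intro r hr
  simp only [Finset.mem_filter] at hr ⊢
  refine ⟨hr.1, lt_of_lt_of_le hr.2 ?_⟩
  apply Nat.add_le_add_left
  apply Finset.card_le_card
  intro j hj
  simp only [Finset.mem_filter, Finset.mem_univ, true_and] at hj ⊢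
  exact lt_of_lt_of_le hj (h j)

theorem lrZ_mono_k (l N : ℕ) (v : Fin N → ℕ) (k k' : ℕ) (h : k ≤ k') :
    lrZ l N v k ≤ lrZ l N v k' := by
  unfold lrZ
  apply Finset.card_le_card
  intro r hr
  simp only [Finset.mem_filter] at hr ⊢
  exact ⟨hr.1, by omega⟩

theorem lrZ_step (l N : ℕ) (v w : Fin N → ℕ) (h : ∀ j, w j ≤ v j + 1) (k : ℕ) :
    lrZ l N w k ≤ lrZ l N v k + 1 := by
  unfold lrZ
  calc _ ≤ (insert 0 (((range l).filter (fun r => N < k +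
        (univ.filter (fun j : Fin N => r < v j)).card)).map ⟨Nat.succ, Nat.succ_injective⟩)).card := by
        apply Finset.card_le_card
        intro r hr
        simp only [Finset.mem_filter, Finset.mem_range] at hr
        simp only [Finset.mem_insert, Finset.mem_map, Finset.mem_filter, Finset.mem_range,
          Function.Embedding.coeFn_mk]
        cases r with
        | zero => left; rfl
        | succ r =>
          right
          refine ⟨r, ⟨by omega, lt_of_lt_of_le hr.2 ?_⟩, rfl⟩
          apply Nat.add_le_add_left
          apply Finset.card_le_card
          intro j hj
          simp only [Finset.mem_filter, Finset.mem_univ, true_and] at hj ⊢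
          have := h j
          omega
    _ ≤ _ := by
        refine (Finset.card_insert_le _ _).trans ?_
        rw [Finset.card_map]

theorem lrZ_zero (l N k : ℕ) (hk : k ≤ N) : lrZ l N (fun _ => 0) k = 0 := by
  unfold lrZ
  simp; omega

theorem lrZ_k0 (l N : ℕ) (v : Fin N → ℕ) : lrZ l N v 0 = 0 := by
  unfold lrZ
  rw [Finset.card_eq_zero, Finset.filter_eq_empty_iff]
  intro r _
  have := Finset.card_le_univ (univ.filter (fun j : Fin N => r < v j))
  simp at this ⊢
  exact this

/-- sum of the `k` smallest values -/
def lrF (l N : ℕ) (v : Fin N → ℕ) (k : ℕ) : ℕ :=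
  ∑ r ∈ range l, (k + (univ.filter (fun j : Fin N => r < v j)).card - N)

theorem lrF_eq (l N : ℕ) (v : Fin N → ℕ) (k : ℕ) :
    ∑ k' ∈ range k, lrZ l N v (k' + 1) = lrF l N v k := by
  induction k with
  | zero =>
    unfold lrF
    simp only [Finset.range_zero, Finset.sum_empty]
    symm
    apply Finset.sum_eq_zero
    intro r _
    have := Finset.card_le_univ (univ.filter (fun j : Fin N => r < v j))
    simp only [Fintype.card_fin] at this
    omega
  | succ k ih =>
    rw [Finset.sum_range_succ, ih]
    unfold lrF lrZ
    rw [Finset.card_filter, ← Finset.sum_add_distrib]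
    apply Finset.sum_congr rfl
    intro r _
    split_ifs <;> omega

theorem lr_sum_eq (l N : ℕ) (v : Fin N → ℕ) (hv : ∀ j, v j ≤ l) (J : Finset (Fin N)) :
    ∑ j ∈ J, v j = ∑ r ∈ range l, (J.filter (fun j => r < v j)).card := by
  simp only [Finset.card_filter]
  rw [Finset.sum_comm]
  apply Finset.sum_congr rfl
  intro j _
  rw [← Finset.card_filter]
  have : (range l).filter (fun r => r < v j) = range (v j) := by
    ext r
    have := hv j
    simp; omega
  rw [this, Finset.card_range]

theorem lrF_le (l N : ℕ) (v : Fin N → ℕ) (hv : ∀ j, v j ≤ l) (J : Finset (Fin N)) :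
    lrF l N v J.card ≤ ∑ j ∈ J, v j := by
  rw [lr_sum_eq l N v hv]
  unfold lrF
  apply Finset.sum_le_sum
  intro r _
  have h := Finset.card_union_add_card_inter J (univ.filter (fun j : Fin N => r < v j))
  have h2 := Finset.card_le_univ (J ∪ (univ.filter (fun j : Fin N => r < v j)))
  simp only [Fintype.card_fin] at h2
  have h3 : J ∩ (univ.filter (fun j : Fin N => r < v j)) = J.filter (fun j => r < v j) := by
    ext; simp
  rw [h3] at h
  omega

theorem lrF_sorted (l N : ℕ) (v : Fin N → ℕ) (hv : ∀ j, v j ≤ l) (J : Finset (Fin N))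
    (hJ : ∀ p ∈ J, ∀ q, q ∉ J → v p ≤ v q) :
    lrF l N v J.card = ∑ j ∈ J, v j := by
  rw [lr_sum_eq l N v hv]
  unfold lrF
  apply Finset.sum_congr rfl
  intro r _
  have h := Finset.card_union_add_card_inter J (univ.filter (fun j : Fin N => r < v j))
  have h3 : J ∩ (univ.filter (fun j : Fin N => r < v j)) = J.filter (fun j => r < v j) := by
    ext; simp
  rw [h3] at h
  have h2 := Finset.card_le_univ (J ∪ (univ.filter (fun j : Fin N => r < v j)))
  simp only [Fintype.card_fin] at h2
  by_cases hE : J.filter (fun j => r < v j) = ∅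
  · rw [hE] at h ⊢
    simp at h ⊢
    omega
  · obtain ⟨p, hp⟩ := Finset.nonempty_iff_ne_empty.2 hE
    simp only [Finset.mem_filter] at hp
    have : J ∪ (univ.filter (fun j : Fin N => r < v j)) = univ := by
      ext q
      simp only [Finset.mem_union, Finset.mem_filter, Finset.mem_univ, true_and, iff_true]
      by_cases hq : q ∈ J
      · exact Or.inl hq
      · exact Or.inr (lt_of_lt_of_le hp.2 (hJ p hp.1 q hq))
    rw [this] at h
    simp at h
    omega

theorem lr_exists_sorted (N : ℕ) (key : Fin N → ℕ) (k : ℕ) (hk : k ≤ N) :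
    ∃ J : Finset (Fin N), J.card = k ∧ ∀ p ∈ J, ∀ q, q ∉ J → key p ≤ key q := by
  induction k with
  | zero => exact ⟨∅, by simp, by simp⟩
  | succ k ih =>
    obtain ⟨J, hJ, h⟩ := ih (by omega)
    have hne : (Jᶜ).Nonempty := by
      rw [← Finset.card_pos, Finset.card_compl, hJ]
      simp; omega
    obtain ⟨m, hm, hmin⟩ := Finset.exists_min_image _ key hne
    have hm' : m ∉ J := by simpa using hm
    refine ⟨insert m J, by rw [Finset.card_insert_of_notMem hm', hJ], ?_⟩
    intro p hp q hq
    simp only [Finset.mem_insert, not_or] at hp hq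
    rcases hp with rfl | hp
    · exact hmin q (by simpa using hq.2)
    · exact h p hp q hq.2

theorem lr_exists_lex (N : ℕ) (v : Fin N → ℕ) (k : ℕ) (hk : k ≤ N) :
    ∃ J : Finset (Fin N), J.card = k ∧ ∀ p ∈ J, ∀ q, q ∉ J → v p < v q ∨ (v p = v q ∧ q ≤ p) := by
  obtain ⟨J, hJ, h⟩ := lr_exists_sorted N (fun j => v j * N + (N - 1 - j.val)) k hk
  refine ⟨J, hJ, fun p hp q hq => ?_⟩
  have := h p hp q hq
  have hp' := p.isLt
  have hq' := q.isLt
  rcases lt_trichotomy (v p) (v q) with h1 | h1 | h1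
  · exact Or.inl h1
  · right
    refine ⟨h1, ?_⟩
    rw [h1] at this
    rw [Fin.le_def]
    omega
  · exfalso
    have : (v q + 1) * N ≤ v p * N := Nat.mul_le_mul_right N h1
    rw [add_mul, one_mul] at this
    omega

theorem lrCnt_step_le (S : Finset (Fin l)) (i : ℕ) : lrCnt S (i + 1) ≤ lrCnt S i + 1 := by
  by_cases h : i < l
  · by_cases h' : (⟨i, h⟩ : Fin l) ∈ S
    · exact (lrCnt_succ_mem S ⟨i, h⟩ h').le
    · have := lrCnt_succ S ⟨i, h⟩ h'
      simp only at this
      omega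
  · have : lrCnt S (i + 1) ≤ lrCnt S i := by
      unfold lrCnt
      apply Finset.card_le_card
      intro x hx
      simp only [Finset.mem_filter] at hx ⊢
      exact ⟨hx.1, by have := x.isLt; omega⟩
    omega

theorem lrCnt_mono (S : Finset (Fin l)) {i j : ℕ} (h : i ≤ j) : lrCnt S i ≤ lrCnt S j := by
  unfold lrCnt
  apply Finset.card_le_card
  intro x hx
  simp only [Finset.mem_filter] at hx ⊢
  exact ⟨hx.1, by omega⟩

theorem lrInd_cnt (S : Finset (Fin l)) (a : Fin l) :
    lrCnt S (a.val + 1) = lrCnt S a.val + lrInd S a := by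
  unfold lrInd
  split_ifs with h
  · exact lrCnt_succ_mem S a h
  · exact lrCnt_succ S a h

theorem lrCnt_card_le (S : Finset (Fin l)) (i : ℕ) : lrCnt S i ≤ l := by
  refine (Finset.card_filter_le _ _).trans ?_
  simpa using Finset.card_le_univ S

theorem lrCnt_big (S : Finset (Fin l)) (i : ℕ) (h : l ≤ i) : lrCnt S i = lrCnt S l := by
  unfold lrCnt
  congr 1
  ext x
  have := x.isLt
  simp only [Finset.mem_filter, and_congr_right_iff]
  intro _
  omega

theorem lr_merge (N : ℕ) (U : Fin N → Finset (Fin l)) (μ : Fin l → ℕ)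
    (hC : ∀ a b : Fin l, b.val = a.val + 1 → ∀ J : Finset (Fin N),
      (∀ p ∈ J, ∀ q, q ∉ J → lrCnt (U p) b.val < lrCnt (U q) b.val ∨
        (lrCnt (U p) b.val = lrCnt (U q) b.val ∧ q ≤ p)) →
      μ b + ∑ j ∈ J, lrInd (U j) b ≤ μ a + ∑ j ∈ J, lrInd (U j) a) :
    lrReach (lrCs l N (fun j => (U j).card)) ∅ μ (μ + ∑ j, lrInd (U j)) := by
  classical
  set x : ℕ → Fin N → ℕ := fun i j => lrCnt (U j) i with hx
  set Z : ℕ → Finset (Fin l) := fun k =>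
    univ.filter (fun i : Fin l => lrZ l N (x i.val) k < lrZ l N (x (i.val + 1)) k) with hZ
  have hxl : ∀ i j, x i j ≤ l := fun i j => lrCnt_card_le _ _
  have hcnt : ∀ k, k ≤ N → ∀ i, i ≤ l → lrCnt (Z k) i = lrZ l N (x i) k := by
    intro k hk i
    induction i with
    | zero =>
      intro _
      have h0 : x 0 = fun _ => 0 := by
        ext j; simp [hx, lrCnt]
      rw [h0, lrZ_zero l N k hk]
      simp [lrCnt]
    | succ i ih =>
      intro hi
      have h1 := ih (by omega)
      have h2 : lrZ l N (x i) k ≤ lrZ l N (x (i + 1)) k :=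
        lrZ_mono l N _ _ (fun j => lrCnt_mono _ (by omega)) k
      have h3 : lrZ l N (x (i + 1)) k ≤ lrZ l N (x i) k + 1 :=
        lrZ_step l N _ _ (fun j => lrCnt_step_le _ _) k
      have h4 := lrInd_cnt (Z k) ⟨i, by omega⟩
      simp only at h4
      rw [h4, h1]
      simp only [lrInd, hZ, Finset.mem_filter, Finset.mem_univ, true_and]
      split_ifs <;> omega
  have hZ0 : Z 0 = ∅ := by
    simp only [hZ, lrZ_k0]; simp
  have hF : ∀ k ≤ N, ∀ i ≤ l, ∑ k' ∈ range k, lrCnt (Z (k' + 1)) i = lrF l N (x i) k := by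
    intro k hk i hi
    rw [← lrF_eq]
    apply Finset.sum_congr rfl
    intro k' hk'
    exact hcnt _ (by have := Finset.mem_range.1 hk'; omega) i hi
  have hFi : ∀ k ≤ N, ∀ a : Fin l, lrF l N (x (a.val + 1)) k = lrF l N (x a.val) k +
      (∑ k' ∈ range k, lrInd (Z (k' + 1))) a := by
    intro k hk a
    rw [← hF k hk _ (by omega), ← hF k hk _ (by omega), Finset.sum_apply, ← Finset.sum_add_distrib]
    apply Finset.sum_congr rfl
    intro k' _
    exact lrInd_cnt _ a
  have hanti : ∀ k ≤ N, Antitone (μ + ∑ k' ∈ range k, lrInd (Z (k' + 1))) := by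
    intro k hk
    by_contra hn
    obtain ⟨a, b, hab, hlt⟩ := lr_not_antitone _ hn
    obtain ⟨J, hJ, hs⟩ := lr_exists_lex N (x b.val) k hk
    have h1 := hC a b hab J hs
    have h2 := lrF_sorted l N (x b.val) (hxl _) J (fun p hp q hq => by
      rcases hs p hp q hq with h | h
      · exact h.le
      · exact h.1.le)
    have h3 := lrF_le l N (x a.val) (hxl _) J
    have h4 := lrF_le l N (x (b.val + 1)) (hxl _) J
    have h5 := hFi k hk a
    have h6 := hFi k hk b
    rw [hJ] at h2 h3 h4
    have e1 : ∑ j ∈ J, x (a.val + 1) j = ∑ j ∈ J, x a.val j + ∑ j ∈ J, lrInd (U j) a := by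
      rw [← Finset.sum_add_distrib]
      exact Finset.sum_congr rfl (fun j _ => lrInd_cnt _ a)
    have e2 : ∑ j ∈ J, x (b.val + 1) j = ∑ j ∈ J, x b.val j + ∑ j ∈ J, lrInd (U j) b := by
      rw [← Finset.sum_add_distrib]
      exact Finset.sum_congr rfl (fun j _ => lrInd_cnt _ b)
    rw [← hab] at e1 h5
    simp only [Pi.add_apply] at hlt
    omega
  have hle : ∀ k < N, lrLe (Z (k + 1)) (Z k) := by
    intro k hk i
    by_cases hi : i ≤ l
    · rw [hcnt _ (by omega) i hi, hcnt _ (by omega) i hi]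
      exact lrZ_mono_k _ _ _ _ _ (by omega)
    · rw [lrCnt_big _ i (by omega), lrCnt_big (Z (k+1)) i (by omega), hcnt _ (by omega) l le_rfl,
        hcnt _ (by omega) l le_rfl]
      exact lrZ_mono_k _ _ _ _ _ (by omega)
  have main := lrReach_of_seq N Z μ hle (fun k hk => hanti (k + 1) (by omega))
  rw [hZ0] at main
  have hcs : lrCs l N (fun j => (U j).card) =
      (List.range N).map (fun k => (Z (k + 1)).card) := by
    unfold lrCs
    apply List.map_congr_left
    intro k hk
    have : k < N := List.mem_range.1 hk
    rw [← lrCnt_top, hcnt _ (by omega) l le_rfl]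
    congr 1
    ext j
    exact (lrCnt_top _).symm
  rw [hcs]
  have hfin : ∑ k' ∈ range N, lrInd (Z (k' + 1)) = ∑ j, lrInd (U j) := by
    ext a
    have h5 := hFi N le_rfl a
    have hall : ∀ i, lrF l N (x i) N = ∑ j, x i j := by
      intro i
      have := lrF_sorted l N (x i) (hxl i) univ (by simp)
      simpa using this
    rw [hall, hall] at h5
    have e1 : ∑ j, x (a.val + 1) j = ∑ j, x a.val j + ∑ j, lrInd (U j) a := by
      rw [← Finset.sum_add_distrib]
      exact Finset.sum_congr rfl (fun j _ => lrInd_cnt _ a)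
    rw [Finset.sum_apply a univ]
    omega
  rw [hfin] at main
  exact main

/-- the Schur polynomial as generating function of column tableaux -/
theorem lr_schur_colLen (A : Fin l → ℕ) (hA : Antitone A) (N : ℕ) (hN : ∀ i, A i ≤ N) :
    schur l A = lrP l (lrCs l N (fun j => colLen l A (j.val + 1))) ∅ := by
  classical
  have hcol : ∀ (r : Fin l) (j : ℕ), r.val < colLen l A (j + 1) ↔ j < A r := by
    intro r j
    have h := lr_initial (univ.filter (fun i => j + 1 ≤ A i)) (by
      intro a b hab hb
      simp only [Finset.mem_filter, Finset.mem_univ, true_and] at hb ⊢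
      exact hb.trans (hA hab))
    have h2 : r ∈ (univ.filter (fun i => j + 1 ≤ A i)) ↔ r ∈ lrSeg l (colLen l A (j + 1)) := by
      unfold colLen
      rw [← h]
    simp only [lrSeg, Finset.mem_filter, Finset.mem_univ, true_and] at h2
    rw [← h2]; omega
  have hy : ∀ r : Fin l, (univ.filter (fun j : Fin N => r.val < colLen l A (j.val + 1))).card = A r := by
    intro r
    simp only [hcol]
    have := lrSeg_cnt (l := N) (A r) N (hN r)
    rw [lrCnt_top] at this
    unfold lrSeg at this
    rw [this]
    have := hN r
    omega
  have hz : ∀ k, ∀ i : Fin l, i.val < lrZ l N (fun j => colLen l A (j.val + 1)) k ↔ N < k + A i := by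
    intro k i
    have h := lr_initial (univ.filter (fun i => N < k + A i)) (by
      intro a b hab hb
      simp only [Finset.mem_filter, Finset.mem_univ, true_and] at hb ⊢
      have := hA hab
      omega)
    have h2 : i ∈ (univ.filter (fun i => N < k + A i)) ↔
        i ∈ lrSeg l (univ.filter (fun i => N < k + A i)).card := by
      rw [← h]
    simp only [lrSeg, Finset.mem_filter, Finset.mem_univ, true_and] at h2
    rw [h2]
    have e : lrZ l N (fun j => colLen l A (j.val + 1)) k =
        (univ.filter (fun i => N < k + A i)).card := by
      unfold lrZ
      rw [← Finset.card_map Fin.valEmbedding]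
      congr 1
      ext r
      simp only [Finset.mem_filter, Finset.mem_range, Finset.mem_map, Finset.mem_univ, true_and,
        Fin.valEmbedding_apply]
      constructor
      · rintro ⟨h1, h2⟩
        exact ⟨⟨r, h1⟩, by rw [hy ⟨r, h1⟩] at h2; exact h2, rfl⟩
      · rintro ⟨y, h1, rfl⟩
        exact ⟨y.isLt, by rw [hy y]; exact h1⟩
    rw [e]
  apply lr_schur_eq
  · unfold lrCs
    apply List.Pairwise.sortedLE
    rw [List.pairwise_map]
    refine List.Pairwise.imp ?_ List.pairwise_lt_range
    intro a b hab
    exact lrZ_mono_k _ _ _ _ _ (by omega)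
  · intro c hc
    unfold lrCs at hc
    simp only [List.mem_map] at hc
    obtain ⟨k, _, rfl⟩ := hc
    refine (Finset.card_filter_le _ _).trans (by simp)
  · intro i
    unfold lrCs
    rw [List.filter_map, List.length_map]
    have e : ∀ k : ℕ, ((fun c => decide (i.val < c)) ∘ fun k => lrZ l N (fun j => colLen l A (j.val + 1)) (k + 1)) k
        = decide (N < k + 1 + A i) := by
      intro k
      simp only [Function.comp]
      congr 1
      exact propext (hz (k + 1) i)
    rw [List.filter_congr (fun k _ => e k)]
    have h1 : ((List.range N).filter (fun k => decide (N < k + 1 + A i))).length =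
        ((Finset.range N).filter (fun k => N < k + 1 + A i)).card := rfl
    rw [h1]
    have h2 : (Finset.range N).filter (fun k => N < k + 1 + A i) = Finset.Ico (N - A i) N := by
      ext k
      simp only [Finset.mem_filter, Finset.mem_range, Finset.mem_Ico]
      omega
    rw [h2, Nat.card_Ico]
    have := hN i
    omega

end merge

/-! ### Explicit paths -/

section paths
variable {l ι : ℕ}

theorem lr_paths (N L : ℕ) (v : Fin N → ℕ) (R : ℕ → Fin N → Fin l → ℕ)
    (h0 : ∀ j, R 0 j = 0)
    (h1 : ∀ t, t < L → ∀ j i, R t j i ≤ R (t + 1) j i ∧ R (t + 1) j i ≤ R t j i + 1)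
    (h2 : ∀ t, t ≤ L → ∀ j, ∑ i, R t j i = t * v j)
    (h3 : ∀ t, t < L → ∀ J : Finset (Fin N),
      Antitone (fun i => ∑ j, if j ∈ J then R (t + 1) j i else R t j i)) :
    Antitone (fun i => ∑ j, R L j i) ∧
    0 < schurMult l (fun i => ∑ j, R L j i) (lrP l (lrCs l N v) ∅ ^ L) := by
  classical
  have hM : ∀ t, t ≤ L → Antitone (fun i => ∑ j, R t j i) := by
    intro t ht
    rcases t with _ | t
    · intro a b _
      simp [h0]
    · simpa using h3 t (by omega) univ
  refine ⟨hM L le_rfl, ?_⟩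
  refine lr_pos (lrCs l N v) L (fun t i => ∑ j, R t j i) ?_ hM ?_
  · funext i
    simp [h0]
  · intro t ht
    set U : Fin N → Finset (Fin l) := fun j => univ.filter (fun i => R (t + 1) j i = R t j i + 1) with hU
    have hI : ∀ j i, R (t + 1) j i = R t j i + lrInd (U j) i := by
      intro j i
      have := h1 t ht j i
      simp only [lrInd, hU, Finset.mem_filter, Finset.mem_univ, true_and]
      split_ifs <;> omega
    have hcard : ∀ j, (U j).card = v j := by
      intro j
      have e : (U j).card = ∑ i, lrInd (U j) i := by
        simp [lrInd]
      have e1 := h2 t ht.le j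
      have e2 := h2 (t + 1) ht j
      simp only [hI, Finset.sum_add_distrib] at e2
      rw [e1] at e2
      rw [e]
      have : (t + 1) * v j = t * v j + v j := by ring
      omega
    have hm := lr_merge N U (fun i => ∑ j, R t j i) ?_
    · have e3 : (fun j => (U j).card) = v := funext hcard
      rw [e3] at hm
      have e4 : (fun i => ∑ j, R (t + 1) j i) = (fun i => ∑ j, R t j i) + ∑ j, lrInd (U j) := by
        funext i
        simp only [hI, Finset.sum_add_distrib, Pi.add_apply, Finset.sum_apply]
      show lrReach _ _ (fun i => ∑ j, R t j i) (fun i => ∑ j, R (t + 1) j i)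
      rw [e4]
      exact hm
    · intro a b hab J _
      have h := h3 t ht J (show a ≤ b by rw [Fin.le_def]; omega)
      have e : ∀ i, (∑ j, if j ∈ J then R (t + 1) j i else R t j i) =
          ∑ j, R t j i + ∑ j ∈ J, lrInd (U j) i := by
        intro i
        rw [← Finset.sum_filter_add_sum_filter_not univ (fun j => j ∈ J) (fun j => R t j i)]
        rw [Finset.sum_ite]
        simp only [hI, Finset.sum_add_distrib]
        have : (univ.filter (fun j => j ∈ J)) = J := by ext; simp
        rw [this]
        omega
      simp only [e] at h
      exact h

variable (f : Fin l → Fin ι)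

theorem lr_lt_bstart (hf : Monotone f) (B : Fin ι) (i : Fin l) :
    f i < B ↔ i.val < bstart l ι f B := by
  have h := lr_initial (univ.filter (fun i => f i < B)) (by
    intro a b hab hb
    simp only [Finset.mem_filter, Finset.mem_univ, true_and] at hb ⊢
    exact lt_of_le_of_lt (hf hab) hb)
  have h2 : i ∈ (univ.filter (fun i => f i < B)) ↔ i ∈ lrSeg l (bstart l ι f B) := by
    unfold bstart
    rw [← h]
  simpa [lrSeg] using h2

theorem lr_lt_bend (hf : Monotone f) (B : Fin ι) (i : Fin l) :
    f i ≤ B ↔ i.val < bend l ι f B := by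
  have h := lr_initial (univ.filter (fun i => f i ≤ B)) (by
    intro a b hab hb
    simp only [Finset.mem_filter, Finset.mem_univ, true_and] at hb ⊢
    exact (hf hab).trans hb)
  have h2 : i ∈ (univ.filter (fun i => f i ≤ B)) ↔ i ∈ lrSeg l (bend l ι f B) := by
    unfold bend
    rw [← h]
  simpa [lrSeg] using h2

theorem lr_bend_eq (B : Fin ι) : bend l ι f B = bstart l ι f B + bsize l ι f B := by
  unfold bend bstart bsize
  rw [← Finset.card_union_of_disjoint]
  · congr 1
    ext i
    simp [le_iff_lt_or_eq]
  · rw [Finset.disjoint_filter]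
    intro i _ h1 h2
    exact absurd h2 h1.ne

theorem lr_bend_le_l (B : Fin ι) : bend l ι f B ≤ l :=
  (Finset.card_filter_le _ _).trans (by simp)

theorem lr_bend_le_bstart (B C : Fin ι) (h : B < C) : bend l ι f B ≤ bstart l ι f C := by
  unfold bend bstart
  apply Finset.card_le_card
  intro i hi
  simp only [Finset.mem_filter, Finset.mem_univ, true_and] at hi ⊢
  exact lt_of_le_of_lt hi h

theorem lr_mem_block (hf : Monotone f) (B : Fin ι) (i : Fin l) :
    f i = B ↔ bstart l ι f B ≤ i.val ∧ i.val < bend l ι f B := by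
  rw [← lr_lt_bend f hf, ← not_lt, ← lr_lt_bstart f hf, not_lt]
  constructor
  · rintro rfl; exact ⟨le_rfl, le_rfl⟩
  · rintro ⟨h1, h2⟩; exact le_antisymm h2 h1

/-- number of rows of block `B` among the first `c` rows -/
def lrQ (c : ℕ) (B : Fin ι) : ℕ := (univ.filter (fun i : Fin l => f i = B ∧ i.val < c)).card

theorem lrQ_le (c : ℕ) (B : Fin ι) : lrQ f c B ≤ bsize l ι f B := by
  apply Finset.card_le_card
  intro i hi
  simp only [Finset.mem_filter, Finset.mem_univ, true_and] at hi ⊢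
  exact hi.1

theorem lrQ_mono (c d : ℕ) (h : c ≤ d) (B : Fin ι) : lrQ f c B ≤ lrQ f d B := by
  apply Finset.card_le_card
  intro i hi
  simp only [Finset.mem_filter, Finset.mem_univ, true_and] at hi ⊢
  exact ⟨hi.1, by omega⟩

theorem lrQ_full (hf : Monotone f) (c : ℕ) (B : Fin ι) (h : bend l ι f B ≤ c) :
    lrQ f c B = bsize l ι f B := by
  unfold lrQ bsize
  congr 1
  ext i
  simp only [Finset.mem_filter, Finset.mem_univ, true_and, and_iff_left_iff_imp]
  intro h1
  have := (lr_mem_block f hf B i).1 h1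
  omega

theorem lrQ_zero (hf : Monotone f) (c : ℕ) (B : Fin ι) (h : c ≤ bstart l ι f B) :
    lrQ f c B = 0 := by
  unfold lrQ
  rw [Finset.card_eq_zero, Finset.filter_eq_empty_iff]
  intro i _ ⟨h1, h2⟩
  have := (lr_mem_block f hf B i).1 h1
  omega

theorem lrQ_pos (c : ℕ) (i : Fin l) (h : i.val < c) : 0 < lrQ f c (f i) := by
  unfold lrQ
  rw [Finset.card_pos]
  exact ⟨i, by simp [h]⟩

theorem lrQ_lt (c : ℕ) (i : Fin l) (h : c ≤ i.val) : lrQ f c (f i) < bsize l ι f (f i) := by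
  apply Finset.card_lt_card
  rw [Finset.ssubset_iff_of_subset]
  · exact ⟨i, by simp, by simp [h]⟩
  · intro i hi
    simp only [Finset.mem_filter, Finset.mem_univ, true_and] at hi ⊢
    exact hi.1

theorem lrQ_sum (c : ℕ) (hc : c ≤ l) : ∑ B, lrQ f c B = c := by
  have h := Finset.card_eq_sum_card_fiberwise (f := f) (s := univ.filter (fun i : Fin l => i.val < c))
    (t := univ) (by simp)
  have h2 : (univ.filter (fun i : Fin l => i.val < c)).card = c := by
    rw [Fin.card_filter_val_lt]; omega
  rw [h2] at h
  refine Eq.trans ?_ h.symm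
  apply Finset.sum_congr rfl
  intro B _
  unfold lrQ
  congr 1
  ext i
  simp [and_comm]

theorem lr_hermite (b : ℕ) (hb : 0 < b) (X : ℕ) : ∑ i ∈ range b, (X + i) / b = X := by
  induction X with
  | zero =>
    apply Finset.sum_eq_zero
    intro i hi
    simp only [zero_add]
    exact Nat.div_eq_of_lt (Finset.mem_range.1 hi)
  | succ X ih =>
    have h1 := Finset.sum_range_succ (fun i => (X + i) / b) b
    have h2 := Finset.sum_range_succ' (fun i => (X + i) / b) b
    have h3 : ∀ i, (X + 1 + i) / b = (X + (i + 1)) / b := fun i => by congr 1; omega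
    simp only [h3]
    rw [Nat.add_div_right _ hb] at h1
    simp only [add_zero] at h2
    omega

theorem lr_sum_block (hf : Monotone f) (B : Fin ι) (g : ℕ → ℕ) :
    ∑ i ∈ univ.filter (fun i => f i = B), g i.val =
      ∑ k ∈ range (bsize l ι f B), g (bend l ι f B - 1 - k) := by
  have he := lr_bend_eq f B
  have hl := lr_bend_le_l f B
  refine Finset.sum_bij' (fun i _ => bend l ι f B - 1 - i.val)
    (fun k hk => ⟨bend l ι f B - 1 - k, by simp only [Finset.mem_range] at hk; omega⟩) ?_ ?_ ?_ ?_ ?_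
  · intro i hi
    simp only [Finset.mem_filter, Finset.mem_univ, true_and, lr_mem_block f hf] at hi
    simp only [Finset.mem_range]
    omega
  · intro k hk
    simp only [Finset.mem_range] at hk
    simp only [Finset.mem_filter, Finset.mem_univ, true_and, lr_mem_block f hf]
    omega
  · intro i hi
    simp only [Finset.mem_filter, Finset.mem_univ, true_and, lr_mem_block f hf] at hi
    ext
    simp only
    omega
  · intro k hk
    simp only [Finset.mem_range] at hk
    simp only
    omega
  · intro i hi
    simp only [Finset.mem_filter, Finset.mem_univ, true_and, lr_mem_block f hf] at hi
    congr 1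
    omega

/-- the normal path of a column of length `c` -/
def lrR (t c : ℕ) (i : Fin l) : ℕ :=
  (t * lrQ f c (f i) + (bend l ι f (f i) - 1 - i.val)) / bsize l ι f (f i)

theorem lr_bsize_pos (i : Fin l) : 0 < bsize l ι f (f i) := by
  unfold bsize
  rw [Finset.card_pos]
  exact ⟨i, by simp⟩

theorem lrR_off (hf : Monotone f) (i : Fin l) :
    bend l ι f (f i) - 1 - i.val < bsize l ι f (f i) := by
  have := (lr_mem_block f hf (f i) i).1 rfl
  have := lr_bend_eq f (f i)
  omega

theorem lrR_zero (hf : Monotone f) (c : ℕ) (i : Fin l) : lrR f 0 c i = 0 := by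
  unfold lrR
  rw [zero_mul, zero_add]
  exact Nat.div_eq_of_lt (lrR_off f hf i)

theorem lrR_step (t c : ℕ) (i : Fin l) :
    lrR f t c i ≤ lrR f (t + 1) c i ∧ lrR f (t + 1) c i ≤ lrR f t c i + 1 := by
  have hb := lr_bsize_pos f i
  have hq := lrQ_le f c (f i)
  unfold lrR
  constructor
  · apply Nat.div_le_div_right
    nlinarith
  · rw [← Nat.add_div_right _ hb]
    apply Nat.div_le_div_right
    nlinarith

theorem lrR_full (hf : Monotone f) (t c : ℕ) (i : Fin l) (h : bend l ι f (f i) ≤ c) :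
    lrR f t c i = t := by
  unfold lrR
  rw [lrQ_full f hf c _ h, mul_comm, Nat.mul_add_div (lr_bsize_pos f i),
    Nat.div_eq_of_lt (lrR_off f hf i), add_zero]

theorem lrR_le (hf : Monotone f) (t c : ℕ) (i : Fin l) : lrR f t c i ≤ t := by
  have h := lrR_full f hf t (bend l ι f (f i)) i le_rfl
  conv_rhs => rw [← h]
  unfold lrR
  rw [lrQ_full f hf _ _ le_rfl]
  apply Nat.div_le_div_right
  have := Nat.mul_le_mul_left t (lrQ_le f c (f i))
  omega

theorem lrR_empty (hf : Monotone f) (t c : ℕ) (i : Fin l) (h : c ≤ bstart l ι f (f i)) :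
    lrR f t c i = 0 := by
  unfold lrR
  rw [lrQ_zero f hf c _ h, mul_zero, zero_add]
  exact Nat.div_eq_of_lt (lrR_off f hf i)

theorem lrR_antitone (hf : Monotone f) (t c : ℕ) : Antitone (lrR f t c) := by
  intro i k hik
  rcases (hf hik).eq_or_lt with h | h
  · unfold lrR
    rw [h]
    apply Nat.div_le_div_right
    rw [Fin.le_def] at hik
    omega
  · have := lr_bend_le_bstart f _ _ h
    rcases le_total (bend l ι f (f i)) c with h1 | h1
    · rw [lrR_full f hf t c i h1]
      exact lrR_le f hf t c k
    · rw [lrR_empty f hf t c k (by omega)]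
      exact Nat.zero_le _

theorem lrR_sum (hf : Monotone f) (hsurj : Function.Surjective f) (t c : ℕ) (hc : c ≤ l) :
    ∑ i, lrR f t c i = t * c := by
  rw [← Finset.sum_fiberwise (s := univ) (g := f)]
  conv_rhs => rw [← lrQ_sum f c hc, Finset.mul_sum]
  apply Finset.sum_congr rfl
  intro B _
  have hb : 0 < bsize l ι f B := by
    obtain ⟨i, rfl⟩ := hsurj B
    exact lr_bsize_pos f i
  have he := lr_bend_eq f B
  have h1 : ∑ i ∈ univ.filter (fun i => f i = B), lrR f t c i =
      ∑ i ∈ univ.filter (fun i => f i = B),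
        (fun k => (t * lrQ f c B + (bend l ι f B - 1 - k)) / bsize l ι f B) i.val := by
    apply Finset.sum_congr rfl
    intro i hi
    simp only [Finset.mem_filter, Finset.mem_univ, true_and] at hi
    subst hi
    rfl
  rw [h1, lr_sum_block f hf B
    (fun k => (t * lrQ f c B + (bend l ι f B - 1 - k)) / bsize l ι f B)]
  refine Eq.trans ?_ (lr_hermite (bsize l ι f B) hb (t * lrQ f c B))
  apply Finset.sum_congr rfl
  intro k hk
  simp only [Finset.mem_range] at hk
  congr 2
  omega

theorem lr_dvd (i : Fin l) : bsize l ι f (f i) ∣ Lnum l := by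
  unfold Lnum
  apply Finset.dvd_lcm (f := id)
  rw [Finset.mem_Icc]
  refine ⟨lr_bsize_pos f i, ?_⟩
  have h1 := lr_bend_eq f (f i)
  have h2 := lr_bend_le_l f (f i)
  show bsize l ι f (f i) ≤ l
  omega

theorem lr_Lnum_pos (l : ℕ) : 0 < Lnum l := by
  rw [Nat.pos_iff_ne_zero]
  unfold Lnum
  intro h
  rw [Finset.lcm_eq_zero_iff] at h
  simp at h

theorem lr_l_le (hl : 0 < l) : l ≤ Lnum l := by
  apply Nat.le_of_dvd (lr_Lnum_pos l)
  unfold Lnum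
  apply Finset.dvd_lcm (f := id)
  rw [Finset.mem_Icc]
  omega

theorem lrR_last (hf : Monotone f) (c : ℕ) (i : Fin l) :
    lrR f (Lnum l) c i = Lnum l / bsize l ι f (f i) * lrQ f c (f i) := by
  obtain ⟨u, hu⟩ := lr_dvd f i
  have hb := lr_bsize_pos f i
  unfold lrR
  rw [hu, mul_assoc, Nat.mul_add_div hb, Nat.div_eq_of_lt (lrR_off f hf i),
    Nat.mul_div_cancel_left _ hb, add_zero]

end paths

/-! ### The modified path and the main theorem -/

section final
variable {l ι : ℕ} (f : Fin l → Fin ι)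

/-- the final value of the modified path -/
def lrB (q : ℕ) (e s : ℕ) (i : Fin l) : ℕ :=
  lrR f (Lnum l) q i + (if i.val = s then 1 else 0) - (if i.val = e then 1 else 0)

theorem lrB_basic (hf : Monotone f) (q p : ℕ) (hqp : q ≤ p) (x y : Fin l)
    (hx : x.val + 1 = q) (hy : y.val = p) : ∃ e s : Fin l, f e = f x ∧ f s = f y ∧ e.val = bend l ι f (f x) - 1 ∧
    s.val = bstart l ι f (f y) ∧ e ≠ s ∧ f x ≤ f y ∧ 1 ≤ lrR f (Lnum l) q e ∧
    lrR f (Lnum l) q e = lrR f (Lnum l - 1) q e + 1 ∧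
    lrR f (Lnum l) q s = lrR f (Lnum l - 1) q s := by
  have hxb := (lr_mem_block f hf (f x) x).1 rfl
  have hyb := (lr_mem_block f hf (f y) y).1 rfl
  have hbl := lr_bend_le_l f (f x)
  have hex := lr_bend_eq f (f x)
  have hey := lr_bend_eq f (f y)
  have hLp := lr_Lnum_pos l
  have hqx := lrQ_pos f q x (by omega)
  have hpy := lrQ_lt f p y (by omega)
  have hqy := lrQ_mono f q p hqp (f y)
  have hqx' := lrQ_le f q (f x)
  refine ⟨⟨bend l ι f (f x) - 1, by omega⟩, ⟨bstart l ι f (f y), by omega⟩, ?_⟩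
  have he : f ⟨bend l ι f (f x) - 1, by omega⟩ = f x := by
    rw [lr_mem_block f hf]; simp only; omega
  have hs : f ⟨bstart l ι f (f y), by omega⟩ = f y := by
    rw [lr_mem_block f hf]; simp only; omega
  have hxy : f x ≤ f y := hf (by rw [Fin.le_def]; omega)
  obtain ⟨u, hu⟩ := lr_dvd f x
  obtain ⟨w, hw⟩ := lr_dvd f y
  have hbx := lr_bsize_pos f x
  have hby := lr_bsize_pos f y
  have hu1 : 1 ≤ u := by
    rcases Nat.eq_zero_or_pos u with h | h
    · rw [h] at hu; omega
    · exact h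
  have hE : lrR f (Lnum l) q ⟨bend l ι f (f x) - 1, by omega⟩ = u * lrQ f q (f x) := by
    rw [lrR_last f hf, he]
    conv_lhs => rw [hu]
    rw [Nat.mul_div_cancel_left _ hbx]
  have hS : lrR f (Lnum l) q ⟨bstart l ι f (f y), by omega⟩ = w * lrQ f q (f y) := by
    rw [lrR_last f hf, hs]
    conv_lhs => rw [hw]
    rw [Nat.mul_div_cancel_left _ hby]
  have h1 : 1 ≤ u * lrQ f q (f x) := Nat.mul_pos hu1 hqx
  refine ⟨he, hs, rfl, rfl, ?_, hxy, ?_, ?_, ?_⟩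
  · intro h
    rw [Fin.mk.injEq] at h
    rcases hxy.eq_or_lt with h2 | h2
    · rw [h2] at hqx h hex
      omega
    · have := lr_bend_le_bstart f _ _ h2
      omega
  · rw [hE]; exact h1
  · have hst := lrR_step f (Lnum l - 1) q ⟨bend l ι f (f x) - 1, by omega⟩
    rw [Nat.sub_add_cancel hLp] at hst
    have : lrR f (Lnum l - 1) q ⟨bend l ι f (f x) - 1, by omega⟩ < u * lrQ f q (f x) := by
      unfold lrR
      rw [he]
      simp only
      rw [Nat.sub_self, add_zero, Nat.div_lt_iff_lt_mul hbx]
      have : (Lnum l - 1) * lrQ f q (f x) < Lnum l * lrQ f q (f x) :=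
        Nat.mul_lt_mul_of_pos_right (by omega) hqx
      calc _ < _ := this
        _ = _ := by rw [hu]; ring
    omega
  · have hst := lrR_step f (Lnum l - 1) q ⟨bstart l ι f (f y), by omega⟩
    rw [Nat.sub_add_cancel hLp] at hst
    have : w * lrQ f q (f y) ≤ lrR f (Lnum l - 1) q ⟨bstart l ι f (f y), by omega⟩ := by
      unfold lrR
      rw [hs]
      simp only
      rw [Nat.le_div_iff_mul_le hby]
      have h3 : w * lrQ f q (f y) * bsize l ι f (f y) = Lnum l * lrQ f q (f y) := by
        rw [hw]; ring
      have h4 : Lnum l * lrQ f q (f y) = (Lnum l - 1) * lrQ f q (f y) + lrQ f q (f y) := by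
        conv_lhs => rw [show Lnum l = Lnum l - 1 + 1 by omega]
        ring
      omega
    omega

theorem lrB_antitone (hf : Monotone f) (q p : ℕ) (hqp : q ≤ p) (x y : Fin l)
    (hx : x.val + 1 = q) (hy : y.val = p)
    (T : ℕ) (hT : T = Lnum l ∨ T + 1 = Lnum l) :
    Antitone (fun i => lrB f q (bend l ι f (f x) - 1) (bstart l ι f (f y)) i + lrR f T p i) := by
  obtain ⟨e, s, he, hs, hev, hsv, hes, hxy, h1, h2, h3⟩ := lrB_basic f hf q p hqp x y hx hy
  rw [← hev, ← hsv]
  intro i k hik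
  rcases hik.eq_or_lt with rfl | hik'
  · exact le_rfl
  have hA1 := lrR_antitone f hf (Lnum l) q hik
  have hA2 := lrR_antitone f hf T p hik
  have hxb := (lr_mem_block f hf (f x) x).1 rfl
  have hyb := (lr_mem_block f hf (f y) y).1 rfl
  have hLp := lr_Lnum_pos l
  rw [Fin.lt_def] at hik'
  -- drop at the end of block `m`
  have hP1 : i = e → lrR f (Lnum l) q k = 0 := by
    intro h
    subst h
    apply lrR_empty f hf
    have hk : f x < f k := by
      rw [← not_le, lr_lt_bend f hf]
      omega
    have := lr_bend_le_bstart f _ _ hk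
    omega
  -- drop at the start of block `n`
  have hP2 : k = s → (f x = f y → lrR f (Lnum l) q k + 1 ≤ lrR f (Lnum l) q i ∧ i ≠ e) ∧
      (f x < f y → lrR f T p k + 1 ≤ lrR f T p i) := by
    intro h
    subst h
    have hi : f i < f y := by
      rw [lr_lt_bstart f hf]; omega
    have hib := lr_bend_le_bstart f _ _ hi
    constructor
    · intro hmn
      refine ⟨?_, ?_⟩
      · rw [lrR_full f hf (Lnum l) q i (by rw [hmn] at hxb; omega)]
        have := lrR_le f hf (Lnum l - 1) q k
        omega
      · intro h
        rw [h, he, hmn] at hi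
        exact lt_irrefl _ hi
    · intro hmn
      rw [lrR_full f hf T p i (by omega)]
      obtain ⟨w, hw⟩ := lr_dvd f y
      have hby := lr_bsize_pos f y
      have hbl := lr_bend_le_l f (f y)
      have hey := lr_bend_eq f (f y)
      have hxy' := lr_bend_le_bstart f _ _ hmn
      have hlL := lr_l_le (l := l) (by omega)
      have hw2 : 2 ≤ w := by
        by_contra hcon
        have : w ≤ 1 := by omega
        have : bsize l ι f (f y) * w ≤ bsize l ι f (f y) * 1 := Nat.mul_le_mul_left _ this
        omega
      have hpy := lrQ_lt f p y (by omega)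
      have hle : lrR f (Lnum l) p k + 2 ≤ Lnum l := by
        rw [lrR_last f hf, hs]
        have e1 : Lnum l / bsize l ι f (f y) = w := by
          conv_lhs => rw [hw]
          rw [Nat.mul_div_cancel_left _ hby]
        rw [e1]
        have h5 : w * (lrQ f p (f y) + 1) ≤ w * bsize l ι f (f y) := Nat.mul_le_mul_left _ hpy
        have h6 : w * bsize l ι f (f y) = Lnum l := by rw [hw]; ring
        rw [h6] at h5
        have h7 : w * (lrQ f p (f y) + 1) = w * lrQ f p (f y) + w := by ring
        omega
      rcases hT with hT | hT
      · subst hT; omega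
      · have := (lrR_step f T p k).1
        rw [hT] at this
        omega
  unfold lrB
  simp only [← Fin.ext_iff]
  by_cases c1 : i = e <;> by_cases c2 : k = s
  · have hh := hP2 c2
    have hz := hP1 c1
    have hks : k ≠ e := by rintro rfl; exact hes c2
    have his : i ≠ s := by rintro rfl; exact hes c1.symm
    rcases hxy.eq_or_lt with h | h
    · exact absurd c1 (hh.1 h).2
    · have := hh.2 h
      subst c1
      simp only [c2, if_true, his, if_false] at *
      simp only [hks, if_false]
      omega
  · have hz := hP1 c1
    have his : i ≠ s := by rintro rfl; exact hes c1.symm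
    subst c1
    simp only [c2, if_true, his, if_false]
    omega
  · have hh := hP2 c2
    have hke : k ≠ e := by rintro rfl; exact hes c2
    have his : i ≠ s := by rintro rfl; rw [c2] at hik'; omega
    simp only [c1, c2, hke, if_true, his, if_false] at *
    rcases hxy.eq_or_lt with h | h
    · have := hh.1 h
      split_ifs <;> omega
    · have := hh.2 h
      split_ifs <;> omega
  · simp only [c1, c2, if_false]
    split_ifs <;> omega

theorem lrB_sum (hf : Monotone f) (q p : ℕ) (hqp : q ≤ p) (x y : Fin l)
    (hx : x.val + 1 = q) (hy : y.val = p)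
    (hsurj : Function.Surjective f) (hq : q ≤ l) :
    ∑ i, lrB f q (bend l ι f (f x) - 1) (bstart l ι f (f y)) i = Lnum l * q := by
  obtain ⟨e, s, he, hs, hev, hsv, hes, hxy, h1, h2, h3⟩ := lrB_basic f hf q p hqp x y hx hy
  rw [← hev, ← hsv, ← lrR_sum f hf hsurj (Lnum l) q hq]
  have h : ∑ i, (lrB f q e.val s.val i + if i = e then 1 else 0) =
      ∑ i, (lrR f (Lnum l) q i + if i = s then 1 else 0) := by
    apply Finset.sum_congr rfl
    intro i _
    unfold lrB
    simp only [← Fin.ext_iff]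
    by_cases c1 : i = e
    · subst c1; simp [hes]; omega
    · simp [c1]
  simp only [Finset.sum_add_distrib, Finset.sum_ite_eq', Finset.mem_univ, if_true] at h
  omega

theorem lrB_step (hf : Monotone f) (q p : ℕ) (hqp : q ≤ p) (x y : Fin l)
    (hx : x.val + 1 = q) (hy : y.val = p)
    (i : Fin l) :
    lrR f (Lnum l - 1) q i ≤ lrB f q (bend l ι f (f x) - 1) (bstart l ι f (f y)) i ∧
    lrB f q (bend l ι f (f x) - 1) (bstart l ι f (f y)) i ≤ lrR f (Lnum l - 1) q i + 1 := by
  obtain ⟨e, s, he, hs, hev, hsv, hes, hxy, h1, h2, h3⟩ := lrB_basic f hf q p hqp x y hx hy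
  rw [← hev, ← hsv]
  have hst := lrR_step f (Lnum l - 1) q i
  rw [Nat.sub_add_cancel (lr_Lnum_pos l)] at hst
  unfold lrB
  simp only [← Fin.ext_iff]
  by_cases c1 : i = e
  · subst c1; simp [hes]; omega
  · by_cases c2 : i = s
    · subst c2; simp [c1]; omega
    · simp [c1, c2]; omega

end final
/-- Let `A` be a partition of length at most `l`, `f` a subdivision of
`{1,…,l}`, and `1 ≤ δ < β` column indices with `ã_β > 0` and `ã_δ < l`. With
`m = J(ã_β)` and `n = J(ã_δ + 1)` (block indices of the corresponding rows), the tuple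
`H_J(A,m,n)` is a partition and it has positive multiplicity in `(s_A)^{L(l)}`. -/
theorem HJ_is_partition_in_schur_power (l ι : ℕ) (hl : 0 < l) (A : Fin l → ℕ)
    (hA : Antitone A) (f : Fin l → Fin ι) (hf : Monotone f)
    (hsurj : Function.Surjective f)
    (δ β : ℕ) (hδ : 1 ≤ δ) (hδβ : δ < β) (hβ : 0 < colLen l A β)
    (hδl : colLen l A δ < l) (m n : Fin ι)
    (hm : m = f ⟨colLen l A β - 1, by have := colLen_le l A β; omega⟩)
    (hn : n = f ⟨colLen l A δ, hδl⟩) :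
    (Antitone (HJ l ι f A m n) ∧ ∀ i, 0 ≤ HJ l ι f A m n i) ∧
    0 < schurMult l (fun i => (HJ l ι f A m n i).toNat) ((schur l A) ^ (Lnum l)) := by
  classical
  have hβl := colLen_le l A β
  have hcol : ∀ (r : Fin l) (j : ℕ), r.val < colLen l A (j + 1) ↔ j < A r := by
    intro r j
    have h := lr_initial (univ.filter (fun i => j + 1 ≤ A i)) (by
      intro a b hab hb
      simp only [Finset.mem_filter, Finset.mem_univ, true_and] at hb ⊢
      exact hb.trans (hA hab))
    have h2 : r ∈ (univ.filter (fun i => j + 1 ≤ A i)) ↔ r ∈ lrSeg l (colLen l A (j + 1)) := by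
      unfold colLen
      rw [← h]
    simp only [lrSeg, Finset.mem_filter, Finset.mem_univ, true_and] at h2
    rw [← h2]; omega
  set N := A ⟨0, hl⟩ with hN
  have hAN : ∀ i, A i ≤ N := fun i => hA (by rw [Fin.le_def]; exact Nat.zero_le _)
  have hβN : β - 1 < N := by
    rw [hN, ← hcol ⟨0, hl⟩ (β - 1), show β - 1 + 1 = β by omega]
    exact hβ
  set jb : Fin N := ⟨β - 1, hβN⟩ with hjb
  set jd : Fin N := ⟨δ - 1, by omega⟩ with hjd
  have hne : jd ≠ jb := by
    rw [hjb, hjd, Ne, Fin.mk.injEq]; omega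
  set c : Fin N → ℕ := fun j => colLen l A (j.val + 1) with hc
  have hcb : c jb = colLen l A β := by
    simp only [hc, hjb]; congr 1; omega
  have hcd : c jd = colLen l A δ := by
    simp only [hc, hjd]; congr 1; omega
  have hcl : ∀ j, c j ≤ l := fun j => colLen_le _ _ _
  have hqp : c jb ≤ c jd := by
    rw [hcb, hcd]
    unfold colLen
    apply Finset.card_le_card
    intro i hi
    simp only [Finset.mem_filter, Finset.mem_univ, true_and] at hi ⊢
    omega
  set x : Fin l := ⟨colLen l A β - 1, by omega⟩ with hx
  set y : Fin l := ⟨colLen l A δ, hδl⟩ with hy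
  have hxq : x.val + 1 = c jb := by rw [hcb, hx]; simp only; omega
  have hyp : y.val = c jd := by rw [hcd]
  have hLp := lr_Lnum_pos l
  set Bt : Fin l → ℕ := lrB f (c jb) (bend l ι f (f x) - 1) (bstart l ι f (f y)) with hBt
  have hBa := lrB_antitone f hf (c jb) (c jd) hqp x y hxq hyp
  have hBs := lrB_sum f hf (c jb) (c jd) hqp x y hxq hyp hsurj (hcl jb)
  have hBst := lrB_step f hf (c jb) (c jd) hqp x y hxq hyp
  rw [← hBt] at hBa hBs hBst
  set R : ℕ → Fin N → Fin l → ℕ := fun t j i =>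
    if t = Lnum l ∧ j = jb then Bt i else lrR f t (c j) i with hR
  have key := lr_paths N (Lnum l) c R ?_ ?_ ?_ ?_
  · have hH : ∀ i, HJ l ι f A m n i = ((∑ j, R (Lnum l) j i : ℕ) : ℤ) := by
      intro i
      obtain ⟨e, s, he, hs, hev, hsv, hes, hxy, h1, h2, h3⟩ :=
        lrB_basic f hf (c jb) (c jd) hqp x y hxq hyp
      have hsum : ∑ j, lrR f (Lnum l) (c j) i = GJ l ι f A i := by
        simp only [lrR_last f hf, GJ]
        rw [← Finset.mul_sum]
        congr 1
        unfold bsum lrQ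
        simp only [Finset.card_filter]
        rw [Finset.sum_comm, Finset.sum_filter]
        apply Finset.sum_congr rfl
        intro r _
        by_cases h : f r = f i
        · simp only [h, true_and, if_true]
          have : ∀ j : Fin N, (r.val < c j) = (j.val < A r) := fun j => propext (hcol r j.val)
          simp only [this]
          rw [← Finset.card_filter, Fin.card_filter_val_lt]
          exact min_eq_right (hAN r)
        · simp [h]
      have hRs : ∑ j, R (Lnum l) j i + lrR f (Lnum l) (c jb) i = GJ l ι f A i + Bt i := by
        rw [← hsum, ← Finset.add_sum_erase univ _ (Finset.mem_univ jb),
          ← Finset.add_sum_erase univ (fun j => lrR f (Lnum l) (c j) i) (Finset.mem_univ jb)]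
        have : ∑ j ∈ univ.erase jb, R (Lnum l) j i =
            ∑ j ∈ univ.erase jb, lrR f (Lnum l) (c j) i := by
          apply Finset.sum_congr rfl
          intro j hj
          simp [hR, Finset.ne_of_mem_erase hj]
        rw [this]
        simp only [hR, and_self, if_true]
        omega
      have hB : Bt i + (if i = e then 1 else 0) =
          lrR f (Lnum l) (c jb) i + (if i = s then 1 else 0) := by
        rw [hBt, ← hev, ← hsv]
        unfold lrB
        simp only [← Fin.ext_iff]
        by_cases c1 : i = e
        · subst c1; simp [hes]; omega
        · simp [c1]
      unfold HJ
      rw [hm, hn, ← hev, ← hsv]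
      simp only [← Fin.ext_iff]
      split_ifs at hB ⊢ <;> omega
    have hH2 : (fun i => (HJ l ι f A m n i).toNat) = fun i => ∑ j, R (Lnum l) j i := by
      funext i
      rw [hH, Int.toNat_natCast]
    refine ⟨⟨?_, ?_⟩, ?_⟩
    · intro a b hab
      rw [hH, hH]
      exact_mod_cast key.1 hab
    · intro i
      rw [hH]
      exact Int.natCast_nonneg _
    · rw [hH2, lr_schur_colLen A hA N hAN]
      exact key.2
  · intro j
    funext i
    have : ¬ (0 = Lnum l ∧ j = jb) := by rintro ⟨h, _⟩; omega
    simp only [hR, this, if_false, lrR_zero f hf, Pi.zero_apply]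
  · intro t ht j i
    have h0 : ¬ (t = Lnum l ∧ j = jb) := by rintro ⟨h, _⟩; omega
    simp only [hR, h0, if_false]
    by_cases h : t + 1 = Lnum l ∧ j = jb
    · simp only [h, and_self, if_true]
      have := hBst i
      rw [show Lnum l - 1 = t by omega] at this
      exact this
    · simp only [h, if_false]
      exact lrR_step f t (c j) i
  · intro t ht j
    by_cases h : t = Lnum l ∧ j = jb
    · simp only [hR, h, and_self, if_true]
      exact hBs
    · simp only [hR, h, if_false]
      exact lrR_sum f hf hsurj t (c j) (hcl j)
  · intro t ht J
    have h0 : ∀ j, ¬ (t = Lnum l ∧ j = jb) := by rintro j ⟨h, _⟩; omega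
    by_cases h : t + 1 = Lnum l ∧ jb ∈ J
    · intro a b hab
      simp only
      have hsplit : ∀ i, (∑ j, if j ∈ J then R (t + 1) j i else R t j i) =
          (Bt i + lrR f (if jd ∈ J then t + 1 else t) (c jd) i) +
          ∑ j ∈ (univ.erase jb).erase jd, lrR f (if j ∈ J then t + 1 else t) (c j) i := by
        intro i
        rw [← Finset.add_sum_erase univ _ (Finset.mem_univ jb),
          ← Finset.add_sum_erase (univ.erase jb) _ (Finset.mem_erase.2 ⟨hne, Finset.mem_univ jd⟩),
          ← add_assoc]
        congr 1
        · congr 1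
          · simp [hR, h.1, h.2]
          · simp only [hR, hne, and_false, if_false]
            split_ifs <;> rfl
        · apply Finset.sum_congr rfl
          intro j hj
          have hj1 : j ≠ jb := (Finset.mem_erase.1 (Finset.mem_erase.1 hj).2).1
          simp only [hR, hj1, and_false, if_false]
          split_ifs <;> rfl
      rw [hsplit, hsplit]
      apply Nat.add_le_add
      · refine hBa (if jd ∈ J then t + 1 else t) ?_ hab
        split_ifs
        · exact Or.inl h.1
        · exact Or.inr h.1
      · exact Finset.sum_le_sum (fun j _ => lrR_antitone f hf _ _ hab)
    · intro a b hab
      apply Finset.sum_le_sum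
      intro j _
      by_cases hj : j ∈ J
      · have h1 : ¬ (t + 1 = Lnum l ∧ j = jb) := by
          rintro ⟨h2, rfl⟩; exact h ⟨h2, hj⟩
        simp only [hj, if_true, hR, h1, if_false]
        exact lrR_antitone f hf _ _ hab
      · simp only [hj, if_false, hR, h0]
        exact lrR_antitone f hf _ _ hab
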